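/- arXiv:1503.06640 — 2 statements merged into one kernel-verified Lean document; each statement's English description precedes it below -/
import Mathlib

section
/- Let Δ be an abstract simplicial complex, ω a linear differential, and V a coordinatization of Δ in ℝ^d making Δ a proper geometric simplicial complex. Assume that for some k ≥ 0: (A) with respect to this coordinatization and ω, Δ is toric k-chordal; (B) Δ has no missing faces of dimension > k; and (C) the sequence consisting of the d coordinate differentials Σ_i (v_i)_j ∂/∂x_i (j=1,…,d) followed by ω is regular up to degree k on S̃(Δ). Then this sequence is regular up to every degree (a regular system of parameters), and Δ is Cohen–Macaulay over ℝ. -/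
open MvPolynomial

open MvPolynomial

/-- An abstract simplicial complex on the vertex set `Fin n`:
a collection of finite subsets closed under taking subsets. -/
def IsComplex {n : ℕ} (Δ : Set (Finset (Fin n))) : Prop :=
  ∀ σ ∈ Δ, ∀ τ ⊆ σ, τ ∈ Δ

/-- The vertex set `Δ^(0)` of a simplicial complex. -/
def verts {n : ℕ} (Δ : Set (Finset (Fin n))) : Set (Fin n) := {v | {v} ∈ Δ}

/-- The partial derivative `∂/∂xᵢ` as a linear endomorphism of `ℝ[x₁,…,xₙ]`. -/
noncomputable def pd {n : ℕ} (i : Fin n) : Module.End ℝ (MvPolynomial (Fin n) ℝ) :=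
  (pderiv i).toLinearMap

/-- The constant coefficient differential operator `(x^a)^∨ = ∏ᵢ (∂/∂xᵢ)^(aᵢ)`. -/
noncomputable def monDiff {n : ℕ} (a : Fin n →₀ ℕ) : Module.End ℝ (MvPolynomial (Fin n) ℝ) :=
  ((List.finRange n).map fun i => pd i ^ a i).prod

/-- The stress space `S̃(Δ)`: polynomials annihilated by `q^∨` for every `q` in the
nonface ideal `I_Δ` (equivalently, by `(x^a)^∨` for every monomial generator `x^a` of `I_Δ`). -/
noncomputable def tStress {n : ℕ} (Δ : Set (Finset (Fin n))) :
    Submodule ℝ (MvPolynomial (Fin n) ℝ) :=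
  ⨅ a ∈ {a : Fin n →₀ ℕ | a.support ∉ Δ}, LinearMap.ker (monDiff a)

/-- A linear differential `Σᵢ cᵢ ∂/∂xᵢ`. -/
noncomputable def linDiff {n : ℕ} (c : Fin n → ℝ) : Module.End ℝ (MvPolynomial (Fin n) ℝ) :=
  ∑ i, c i • pd i

/-- The canonical differential `δ = Σᵢ ∂/∂xᵢ`. -/
noncomputable def canDiff (n : ℕ) : Module.End ℝ (MvPolynomial (Fin n) ℝ) :=
  linDiff fun _ => (1 : ℝ)

/-- The coordinate differential `θⱼ = Σᵢ (vᵢ)ⱼ ∂/∂xᵢ` of a geometric simplicial complex. -/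
noncomputable def coordDiff {n d : ℕ} (V : Fin n → Fin d → ℝ) (j : Fin d) :
    Module.End ℝ (MvPolynomial (Fin n) ℝ) :=
  linDiff fun i => V i j

/-- The stress space `S(Δ)` of a geometric simplicial complex with vertex coordinates `V`. -/
noncomputable def stress {n d : ℕ} (V : Fin n → Fin d → ℝ) (Δ : Set (Finset (Fin n))) :
    Submodule ℝ (MvPolynomial (Fin n) ℝ) :=
  tStress Δ ⊓ ⨅ j : Fin d, LinearMap.ker (coordDiff V j)

/-- The degree-`k` graded piece `S_k(Δ)` of the stress space. -/
noncomputable def stressK {n d : ℕ} (V : Fin n → Fin d → ℝ) (Δ : Set (Finset (Fin n)))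
    (k : ℕ) : Submodule ℝ (MvPolynomial (Fin n) ℝ) :=
  stress V Δ ⊓ homogeneousSubmodule (Fin n) ℝ k

/-- A geometric simplicial complex in `ℝ^d` is proper if the coordinates of each face of
dimension `< d` are linearly independent. -/
def IsProper {n d : ℕ} (V : Fin n → Fin d → ℝ) (Δ : Set (Finset (Fin n))) : Prop :=
  ∀ σ ∈ Δ, σ.card ≤ d → LinearIndependent ℝ (fun i : {x // x ∈ σ} => V i.1)

/-- The star of a face. -/
def cStar {n : ℕ} (Δ : Set (Finset (Fin n))) (σ : Finset (Fin n)) : Set (Finset (Fin n)) :=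
  {τ ∈ Δ | σ ∪ τ ∈ Δ}

/-- The star of a vertex. -/
def vStar {n : ℕ} (Δ : Set (Finset (Fin n))) (v : Fin n) : Set (Finset (Fin n)) :=
  cStar Δ {v}

/-- The boundary `∂St_v Δ` of the star of a vertex: faces of the star not containing `v`. -/
def vStarBd {n : ℕ} (Δ : Set (Finset (Fin n))) (v : Fin n) : Set (Finset (Fin n)) :=
  {τ ∈ vStar Δ v | v ∉ τ}

/-- The link of a face. -/
def lk {n : ℕ} (Δ : Set (Finset (Fin n))) (σ : Finset (Fin n)) : Set (Finset (Fin n)) :=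
  {τ | Disjoint σ τ ∧ σ ∪ τ ∈ Δ}

/-- The vertex set `γ^(0)` of the support of a stress `γ`. -/
noncomputable def stressVerts {n : ℕ} (γ : MvPolynomial (Fin n) ℝ) : Finset (Fin n) :=
  γ.support.biUnion fun a => a.support

/-- `g_k = dim S_k − dim S_{k−1}` (with `S_{−1} = 0`). -/
noncomputable def gnum {n d : ℕ} (V : Fin n → Fin d → ℝ) (Δ : Set (Finset (Fin n)))
    (k : ℕ) : ℤ :=
  (Module.finrank ℝ ↥(stressK V Δ k) : ℤ) -
    if k = 0 then 0 else (Module.finrank ℝ ↥(stressK V Δ (k - 1)) : ℤ)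

/-- The homogenizing embedding `ℝ^d → ℝ^d × {1} ⊆ ℝ^{d+1}` applied to vertex coordinates. -/
noncomputable def homV {n d : ℕ} (p : Fin n → Fin d → ℝ) : Fin n → Fin (d + 1) → ℝ :=
  fun i => Fin.snoc (p i) 1

/-- `Δ` is the boundary complex of the simplicial `d`-polytope `conv{p 1, …, p n}`:
the polytope is full-dimensional, every `p i` is a vertex, the faces of `Δ` are exactly the
vertex sets cut out by supporting hyperplanes, and every proper face is a simplex. -/
def IsSimplicialPolytopeBoundary {n d : ℕ} (p : Fin n → Fin d → ℝ)
    (Δ : Set (Finset (Fin n))) : Prop :=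
  affineSpan ℝ (Set.range p) = ⊤ ∧
  (∀ i, p i ∉ convexHull ℝ (p '' {j | j ≠ i})) ∧
  (∀ σ ∈ Δ, AffineIndependent ℝ (fun i : {x // x ∈ σ} => p i.1)) ∧
  (∀ σ : Finset (Fin n), σ ∈ Δ ↔
    ∃ (f : (Fin d → ℝ) →ₗ[ℝ] ℝ) (c : ℝ),
      (∃ i, f (p i) < c) ∧ (∀ i, f (p i) ≤ c) ∧ (∀ i, f (p i) = c ↔ i ∈ σ))

/-- The simplicial boundary operator (with real coefficients), on the free module spanned by
all finite subsets of `Fin n`; the empty set plays the role of the `(−1)`-face, so that the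
associated homology is reduced. -/
noncomputable def bdry {n : ℕ} : (Finset (Fin n) →₀ ℝ) →ₗ[ℝ] (Finset (Fin n) →₀ ℝ) :=
  Finsupp.lsum ℝ fun σ => LinearMap.toSpanSingleton ℝ _
    (∑ i ∈ σ, ((-1 : ℝ) ^ (σ.filter (· < i)).card) • Finsupp.single (σ.erase i) (1 : ℝ))

/-- The space of simplicial `k`-chains of `Δ` (spanned by faces of `Δ` of dimension `k`). -/
noncomputable def chains {n : ℕ} (Δ : Set (Finset (Fin n))) (k : ℤ) :
    Submodule ℝ (Finset (Fin n) →₀ ℝ) :=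
  Finsupp.supported ℝ ℝ {σ | σ ∈ Δ ∧ (σ.card : ℤ) = k + 1}

/-- Reduced simplicial `k`-cycles of `Δ`. -/
noncomputable def cycles {n : ℕ} (Δ : Set (Finset (Fin n))) (k : ℤ) :
    Submodule ℝ (Finset (Fin n) →₀ ℝ) :=
  chains Δ k ⊓ LinearMap.ker bdry

/-- Simplicial `k`-boundaries of `Δ`. -/
noncomputable def bdries {n : ℕ} (Δ : Set (Finset (Fin n))) (k : ℤ) :
    Submodule ℝ (Finset (Fin n) →₀ ℝ) :=
  Submodule.map bdry (chains Δ (k + 1))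

/-- The reduced Betti number `β̃_k(Δ)` (with real coefficients). -/
noncomputable def rBetti {n : ℕ} (Δ : Set (Finset (Fin n))) (k : ℤ) : ℕ :=
  Module.finrank ℝ ↥(cycles Δ k) - Module.finrank ℝ ↥(bdries Δ k)

/-- The induced subcomplex `Δ_W` on a vertex set `W`. -/
def induced {n : ℕ} (Δ : Set (Finset (Fin n))) (W : Finset (Fin n)) : Set (Finset (Fin n)) :=
  {σ ∈ Δ | σ ⊆ W}

/-- The vertex set of the support of a simplicial chain. -/
def chainVerts {n : ℕ} (c : Finset (Fin n) →₀ ℝ) : Finset (Fin n) :=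
  c.support.biUnion id

/-- `Δ` is resolution `k`-chordal: every `k`-cycle `z` admits a resolution, i.e. a
`(k+1)`-chain `c` with `∂c = z` and `c^(0) = z^(0)`. -/
def ResolutionChordal {n : ℕ} (Δ : Set (Finset (Fin n))) (k : ℤ) : Prop :=
  ∀ z ∈ cycles Δ k, ∃ c ∈ chains Δ (k + 1), bdry c = z ∧ chainVerts c = chainVerts z

/-- `(Δ, ω)` is toric `k`-chordal: `ω : S_{k+1}(Δ) → S_k(Δ)` is surjective and
`ω : S_k(Δ) → S_{k−1}(Δ)` is injective. -/
def ToricChordal {n d : ℕ} (V : Fin n → Fin d → ℝ) (Δ : Set (Finset (Fin n)))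
    (ω : Module.End ℝ (MvPolynomial (Fin n) ℝ)) (k : ℕ) : Prop :=
  (∀ γ ∈ stressK V Δ k, ∃ γ' ∈ stressK V Δ (k + 1), ω γ' = γ) ∧
  (∀ γ ∈ stressK V Δ k, ω γ = 0 → γ = 0)

/-- `(Δ, ω)` is weakly toric `k`-chordal: `ω : S_k(St_v Δ) → S_{k−1}(St_v Δ)` is injective
for every vertex `v` of `Δ`. -/
def WeaklyToricChordal {n d : ℕ} (V : Fin n → Fin d → ℝ) (Δ : Set (Finset (Fin n)))
    (ω : Module.End ℝ (MvPolynomial (Fin n) ℝ)) (k : ℕ) : Prop :=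
  ∀ v ∈ verts Δ, ∀ γ ∈ stressK V (vStar Δ v) k, ω γ = 0 → γ = 0

/-- A missing face of `Δ`: a nonface all of whose proper subsets are faces. -/
def IsMissingFace {n : ℕ} (Δ : Set (Finset (Fin n))) (σ : Finset (Fin n)) : Prop :=
  σ ∉ Δ ∧ ∀ τ ⊂ σ, τ ∈ Δ

/-- Representatives of relative `k`-stresses of the relative complex `(Δ', Γ)`:
homogeneous degree-`k` elements of `S̃(Δ')` whose image under each coordinate differential
lies in `S̃(Γ)`.  The relative stress space `S_k(Δ', Γ)` is the quotient of this space by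
(the degree-`k` part of) `S̃(Γ)`. -/
noncomputable def relStressK {n d : ℕ} (V : Fin n → Fin d → ℝ)
    (Δ' Γ : Set (Finset (Fin n))) (k : ℕ) : Submodule ℝ (MvPolynomial (Fin n) ℝ) :=
  tStress Δ' ⊓ homogeneousSubmodule (Fin n) ℝ k ⊓
    ⨅ j : Fin d, (tStress Γ).comap (coordDiff V j)

/-- A shelling of a pure `(d−1)`-dimensional simplicial complex: a linear order on the facets
such that the intersection of each facet with the union of all subsequent facets is a pure
`(d−2)`-dimensional complex or empty. -/
def IsShelling {n : ℕ} (Δ : Set (Finset (Fin n))) (d : ℕ) (L : List (Finset (Fin n))) : Prop :=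
  L.Nodup ∧ (∀ σ, σ ∈ L ↔ σ ∈ Δ ∧ σ.card = d) ∧
  (∀ σ ∈ Δ, ∃ F ∈ L, σ ⊆ F) ∧
  ∀ (i : ℕ) (hi : i < L.length) (τ : Finset (Fin n)), τ ⊆ L.get ⟨i, hi⟩ →
    (∃ (j : ℕ) (hj : j < L.length), i < j ∧ τ ⊆ L.get ⟨j, hj⟩) →
    ∃ ρ, τ ⊆ ρ ∧ ρ ⊆ L.get ⟨i, hi⟩ ∧ ρ.card = d - 1 ∧
      ∃ (j : ℕ) (hj : j < L.length), i < j ∧ ρ ⊆ L.get ⟨j, hj⟩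

/-- The degree-`k` graded piece of the stress space `S̃(Δ)`. -/
noncomputable def tStressK {n : ℕ} (Δ : Set (Finset (Fin n))) (k : ℕ) :
    Submodule ℝ (MvPolynomial (Fin n) ℝ) :=
  tStress Δ ⊓ homogeneousSubmodule (Fin n) ℝ k

/-- A sequence `θ` of linear differentials is regular up to degree `k` on `S̃(Δ)`: each
`θ_j` maps the degree-`(i+1)` part of the common kernel of `θ_1, …, θ_{j−1}` in `S̃(Δ)` onto
the degree-`i` part, for every `i ≤ k`. -/
def RegularUpTo {n : ℕ} (Δ : Set (Finset (Fin n)))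
    (θ : List (Module.End ℝ (MvPolynomial (Fin n) ℝ))) (k : ℕ) : Prop :=
  ∀ j < θ.length, ∀ i ≤ k,
    ∀ γ ∈ tStressK Δ i ⊓ ⨅ l ∈ Finset.range j, LinearMap.ker (θ.getD l 0),
      ∃ γ' ∈ tStressK Δ (i + 1) ⊓ ⨅ l ∈ Finset.range j, LinearMap.ker (θ.getD l 0),
        θ.getD j 0 γ' = γ

/-- `dim Δ + 1`: the maximal cardinality of a face. -/
noncomputable def dim1 {n : ℕ} (Δ : Set (Finset (Fin n))) : ℕ :=
  sSup {m | ∃ σ ∈ Δ, σ.card = m}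

/-- `Δ` is Cohen–Macaulay over `ℝ`: the reduced homology of every face link vanishes below
the expected dimension. -/
def IsCM {n : ℕ} (Δ : Set (Finset (Fin n))) : Prop :=
  ∀ σ ∈ Δ, ∀ i : ℤ, i < (dim1 Δ : ℤ) - 1 - σ.card →
    cycles (lk Δ σ) i ≤ bdries (lk Δ σ) i

/-- `(q, T)` is a triangulation of the simplicial polytope `P = conv{p i}` whose faces contained
in the boundary `∂P` form exactly the boundary complex `Δ` of `P`. -/
def IsTriangulation {n d m : ℕ} (p : Fin n → Fin d → ℝ) (Δ : Set (Finset (Fin n)))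
    (q : Fin m → Fin d → ℝ) (T : Set (Finset (Fin m))) : Prop :=
  IsComplex T ∧
  (∀ σ ∈ T, AffineIndependent ℝ (fun i : {x // x ∈ σ} => q i.1)) ∧
  (∀ σ ∈ T, ∀ τ ∈ T,
    convexHull ℝ (q '' ↑σ) ∩ convexHull ℝ (q '' ↑τ) = convexHull ℝ (q '' ↑(σ ∩ τ))) ∧
  (⋃ σ ∈ T, convexHull ℝ (q '' ↑σ)) = convexHull ℝ (Set.range p) ∧
  {s : Set (Fin d → ℝ) | ∃ σ ∈ T,
      convexHull ℝ (q '' ↑σ) ⊆ frontier (convexHull ℝ (Set.range p)) ∧ s = q '' ↑σ}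
    = {s : Set (Fin d → ℝ) | ∃ σ ∈ Δ, s = p '' ↑σ}

/-- The restriction `Δ_S` of a balanced complex to the set `S` of colors. -/
def colorRestrict {n d : ℕ} (Δ : Set (Finset (Fin n))) (col : Fin n → Fin d)
    (S : Finset (Fin d)) : Set (Finset (Fin n)) :=
  {σ ∈ Δ | ∀ v ∈ σ, col v ∈ S}


section CAR

variable {n : ℕ} {A : Type*} [AddCommGroup A] [Module ℝ A]

/-- The sign `(-1)^#{j ∈ τ : j < i}`. -/
noncomputable def sg (i : Fin n) (τ : Finset (Fin n)) : ℝ := (-1) ^ (τ.filter (· < i)).card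

lemma sg_sq (i : Fin n) (τ : Finset (Fin n)) : sg i τ * sg i τ = 1 := by
  unfold sg
  rw [← mul_pow]; simp

lemma sg_insert_self (i : Fin n) (τ : Finset (Fin n)) : sg i (insert i τ) = sg i τ := by
  unfold sg
  rw [Finset.filter_insert]; simp

lemma sg_erase_self (i : Fin n) (τ : Finset (Fin n)) : sg i (τ.erase i) = sg i τ := by
  unfold sg
  congr 2
  ext j
  simp only [Finset.mem_filter, Finset.mem_erase]
  constructor
  · rintro ⟨⟨_, h⟩, h'⟩; exact ⟨h, h'⟩
  · rintro ⟨h, h'⟩; exact ⟨⟨h'.ne, h⟩, h'⟩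

lemma sg_insert_lt {i j : Fin n} (τ : Finset (Fin n)) (hj : j ∉ τ) (h : j < i) :
    sg i (insert j τ) = - sg i τ := by
  unfold sg
  rw [Finset.filter_insert, if_pos h, Finset.card_insert_of_notMem (by simp [hj]), pow_succ]
  ring

lemma sg_insert_gt {i j : Fin n} (τ : Finset (Fin n)) (h : i < j) :
    sg i (insert j τ) = sg i τ := by
  unfold sg
  rw [Finset.filter_insert, if_neg (not_lt.mpr h.le)]

lemma sg_swap {i j : Fin n} (hij : i ≠ j) (τ : Finset (Fin n)) (hi : i ∉ τ) (hj : j ∉ τ) :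
    sg i τ * sg j (insert i τ) = - (sg j τ * sg i (insert j τ)) := by
  rcases lt_or_gt_of_ne hij with h | h
  · rw [sg_insert_lt τ hi h, sg_insert_gt τ h]; ring
  · rw [sg_insert_lt τ hj h, sg_insert_gt τ h]; ring

lemma sg_union (i : Fin n) (W τ : Finset (Fin n)) (h : τ ⊆ W) :
    sg i τ * sg i (W \ τ) = sg i W := by
  unfold sg
  rw [← pow_add]
  congr 1
  rw [← Finset.card_union_of_disjoint]
  · rw [← Finset.filter_union, Finset.union_sdiff_of_subset h]
  · exact Finset.disjoint_filter_filter Finset.disjoint_sdiff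

/-- Contraction by the `i`-th basis vector. -/
noncomputable def iot (i : Fin n) : Module.End ℝ (Finset (Fin n) → A) where
  toFun f τ := if i ∈ τ then 0 else sg i τ • f (insert i τ)
  map_add' f g := by
    ext τ; by_cases h : i ∈ τ <;> simp [h]
  map_smul' r f := by
    ext τ; by_cases h : i ∈ τ <;> simp [h, smul_comm r]

/-- Exterior multiplication by the `i`-th basis vector. -/
noncomputable def eps (i : Fin n) : Module.End ℝ (Finset (Fin n) → A) where
  toFun f τ := if i ∈ τ then sg i τ • f (τ.erase i) else 0
  map_add' f g := by
    ext τ; by_cases h : i ∈ τ <;> simp [h]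
  map_smul' r f := by
    ext τ; by_cases h : i ∈ τ <;> simp [h, smul_comm r]

lemma iot_apply (i : Fin n) (f : Finset (Fin n) → A) (τ) :
    iot i f τ = if i ∈ τ then 0 else sg i τ • f (insert i τ) := rfl

lemma eps_apply (i : Fin n) (f : Finset (Fin n) → A) (τ) :
    eps i f τ = if i ∈ τ then sg i τ • f (τ.erase i) else 0 := rfl

lemma iot_iot (i j : Fin n) : (iot i * iot j : Module.End ℝ (Finset (Fin n) → A)) = - (iot j * iot i) := by
  refine LinearMap.ext fun f => funext fun τ => ?_
  simp only [Module.End.mul_apply, LinearMap.neg_apply, Pi.neg_apply, iot_apply]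
  by_cases hi : i ∈ τ
  · simp [hi]
  by_cases hj : j ∈ τ
  · simp [hj]
  by_cases hij : i = j
  · subst hij; simp
  have hji : ¬ j = i := fun h => hij h.symm
  simp only [hi, hj, hij, hji, Finset.mem_insert, or_self, if_false, smul_smul]
  rw [sg_swap hij τ hi hj, Finset.insert_comm, neg_smul]

lemma eps_eps (i j : Fin n) : (eps i * eps j : Module.End ℝ (Finset (Fin n) → A)) = - (eps j * eps i) := by
  refine LinearMap.ext fun f => funext fun τ => ?_
  simp only [Module.End.mul_apply, LinearMap.neg_apply, Pi.neg_apply, eps_apply]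
  by_cases hi : i ∈ τ
  swap
  · simp [hi]
  by_cases hj : j ∈ τ
  swap
  · simp [hj]
  by_cases hij : i = j
  · subst hij; simp
  have hji : ¬ j = i := fun h => hij h.symm
  simp only [hi, hj, hij, hji, Finset.mem_erase, ne_eq, not_false_eq_true, and_self, if_true, smul_smul]
  rw [Finset.erase_right_comm, ← neg_smul]
  congr 1
  set ρ := (τ.erase i).erase j with hρ
  have h1 : τ.erase i = insert j ρ := by
    rw [hρ, Finset.insert_erase]; simp [hj, hji]
  have h2 : τ.erase j = insert i ρ := by
    rw [hρ, Finset.erase_right_comm, Finset.insert_erase]; simp [hi, hij]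
  have hiρ : i ∉ ρ := by simp [hρ]
  have hjρ : j ∉ ρ := by simp [hρ]
  rw [← sg_erase_self i τ, ← sg_erase_self j τ, h1, h2, sg_insert_self, sg_insert_self]
  have := sg_swap hij ρ hiρ hjρ
  linarith

lemma iot_eps (i j : Fin n) : (iot i * eps j + eps j * iot i : Module.End ℝ (Finset (Fin n) → A)) =
    if i = j then 1 else 0 := by
  by_cases hij : i = j
  · subst hij
    rw [if_pos rfl]
    refine LinearMap.ext fun f => funext fun τ => ?_
    simp only [Module.End.mul_apply, LinearMap.add_apply, Pi.add_apply, iot_apply, eps_apply,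
      Module.End.one_apply]
    by_cases hi : i ∈ τ
    · simp [hi, smul_smul, sg_erase_self, sg_sq]
    · simp [hi, smul_smul, sg_insert_self, sg_sq]
  · rw [if_neg hij]
    have hji : ¬ j = i := fun h => hij h.symm
    refine LinearMap.ext fun f => funext fun τ => ?_
    simp only [Module.End.mul_apply, LinearMap.add_apply, Pi.add_apply, iot_apply, eps_apply,
      LinearMap.zero_apply, Pi.zero_apply]
    by_cases hi : i ∈ τ
    · simp [hi, hij]
    by_cases hj : j ∈ τ
    swap
    · simp [hj, hji]
    simp only [hi, hj, hij, hji, Finset.mem_erase, Finset.mem_insert, ne_eq, not_false_eq_true,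
      or_true, and_false, if_true, if_false, smul_smul]
    rw [Finset.erase_insert_of_ne hij, ← add_smul]
    set ρ := τ.erase j with hρ
    have h1 : τ = insert j ρ := by rw [hρ, Finset.insert_erase hj]
    have hiρ : i ∉ ρ := by simp [hρ, hi]
    have hjρ : j ∉ ρ := by simp [hρ]
    rw [h1, Finset.insert_comm, sg_insert_self, sg_insert_self]
    have h2 := sg_swap hij ρ hiρ hjρ
    have h3 := sg_sq i ρ
    have h4 := sg_sq j ρ
    convert zero_smul ℝ _
    rcases lt_or_gt_of_ne hij with h | h
    · rw [sg_insert_lt ρ hiρ h, sg_insert_gt ρ h]; ring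
    · rw [sg_insert_lt ρ hjρ h, sg_insert_gt ρ h]; ring

lemma sum_antisymm {B : Type*} [AddCommGroup B] [Module ℝ B] (f : Fin n → Fin n → B)
    (h : ∀ i j, f i j = - f j i) : ∑ i, ∑ j, f i j = 0 := by
  have h1 : ∑ i, ∑ j, f i j = - ∑ i, ∑ j, f i j := by
    conv_lhs => rw [Finset.sum_comm]
    rw [← Finset.sum_neg_distrib]
    refine Finset.sum_congr rfl fun i _ => ?_
    rw [← Finset.sum_neg_distrib]
    exact Finset.sum_congr rfl fun j _ => h j i
  have h2 : (2 : ℝ) • ∑ i, ∑ j, f i j = 0 := by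
    rw [two_smul]; nth_rewrite 1 [h1]; simp
  exact (smul_eq_zero.mp h2).resolve_left two_ne_zero

/-- Apply an operator to all coefficients. -/
def cw (T : Module.End ℝ A) : Module.End ℝ (Finset (Fin n) → A) := LinearMap.compLeft T _

lemma cw_apply (T : Module.End ℝ A) (f : Finset (Fin n) → A) (τ) : cw T f τ = T (f τ) := rfl

lemma cw_eps (T : Module.End ℝ A) (i : Fin n) : cw T * eps i = eps i * cw T := by
  refine LinearMap.ext fun f => funext fun τ => ?_
  simp only [Module.End.mul_apply, cw_apply, eps_apply]
  by_cases h : i ∈ τ <;> simp [h]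

lemma cw_iot (T : Module.End ℝ A) (i : Fin n) : cw T * iot i = iot i * cw T := by
  refine LinearMap.ext fun f => funext fun τ => ?_
  simp only [Module.End.mul_apply, cw_apply, iot_apply]
  by_cases h : i ∈ τ <;> simp [h]

lemma cw_mul (T U : Module.End ℝ A) : (cw T * cw U : Module.End ℝ (Finset (Fin n) → A)) = cw (T * U) := by
  exact LinearMap.ext fun f => funext fun τ => rfl

end CAR

section deRham

variable {n : ℕ}

lemma pd_comm (i j : Fin n) : pd i * pd j = pd j * pd i := by
  refine LinearMap.ext fun p => ?_
  simp only [Module.End.mul_apply, pd, Derivation.coeFn_coe]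
  ext m
  simp only [coeff_pderiv, Finsupp.add_apply, Finsupp.single_apply]
  by_cases h : i = j
  · subst h; rfl
  · have h' : ¬ j = i := fun e => h e.symm
    rw [add_right_comm]
    simp only [h, h', if_false]
    push_cast
    ring

/-- The de Rham differential. -/
noncomputable def dd : Module.End ℝ (Finset (Fin n) → MvPolynomial (Fin n) ℝ) :=
  ∑ i, eps i * cw (pd i)

/-- Contraction with a constant vector field. -/
noncomputable def icon (c : Fin n → ℝ) : Module.End ℝ (Finset (Fin n) → MvPolynomial (Fin n) ℝ) :=
  ∑ i, c i • iot i

lemma dd_apply (f : Finset (Fin n) → MvPolynomial (Fin n) ℝ) (τ) :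
    dd f τ = ∑ i ∈ τ, sg i τ • pd i (f (τ.erase i)) := by
  simp only [dd, LinearMap.sum_apply, Finset.sum_apply, Module.End.mul_apply, eps_apply, cw_apply]
  rw [← Finset.sum_filter]
  simp

lemma icon_apply (c : Fin n → ℝ) (f : Finset (Fin n) → MvPolynomial (Fin n) ℝ) (τ) :
    icon c f τ = ∑ i, c i • iot i f τ := by
  simp [icon, LinearMap.sum_apply, Finset.sum_apply]

lemma dd_dd : (dd * dd : Module.End ℝ (Finset (Fin n) → MvPolynomial (Fin n) ℝ)) = 0 := by
  rw [dd, Finset.sum_mul]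
  simp only [Finset.mul_sum]
  apply sum_antisymm
  intro i j
  calc eps i * cw (pd i) * (eps j * cw (pd j)) = eps i * (cw (pd i) * eps j) * cw (pd j) := by
        simp only [mul_assoc]
    _ = (eps i * eps j) * (cw (pd i) * cw (pd j)) := by rw [cw_eps]; simp only [mul_assoc]
    _ = -((eps j * eps i) * (cw (pd j) * cw (pd i))) := by
        rw [eps_eps, cw_mul, cw_mul, pd_comm]; exact LinearMap.neg_comp _ _
    _ = -(eps j * (cw (pd j) * eps i) * cw (pd i)) := by rw [cw_eps]; simp only [mul_assoc]
    _ = _ := by simp only [mul_assoc]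

lemma cartan (c : Fin n → ℝ) : icon c * dd + dd * icon c = cw (linDiff c) := by
  have h : ∀ i j : Fin n, c i • iot i * (eps j * cw (pd j)) + (eps j * cw (pd j)) * c i • iot i
      = (c i • (if i = j then cw (pd j) else 0) :
        Module.End ℝ (Finset (Fin n) → MvPolynomial (Fin n) ℝ)) := by
    intro i j
    have : (eps j * cw (pd j)) * iot i =
       (eps j * iot i * cw (pd j) : Module.End ℝ (Finset (Fin n) → MvPolynomial (Fin n) ℝ)) := by
      rw [mul_assoc, cw_iot, mul_assoc]
    rw [smul_mul_assoc, mul_smul_comm, this, ← smul_add, ← mul_assoc, ← add_mul, iot_eps]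
    split_ifs <;> simp
  rw [icon, dd, Finset.sum_mul_sum, Finset.sum_mul_sum, Finset.sum_comm (s := Finset.univ) (t := Finset.univ) (f := fun i j => eps i * cw (pd i) * c j • iot j), ← Finset.sum_add_distrib]
  simp only [← Finset.sum_add_distrib, h]
  simp only [smul_ite, smul_zero, Finset.sum_ite_eq, Finset.mem_univ, if_true]
  refine LinearMap.ext fun f => funext fun τ => ?_
  simp [linDiff, LinearMap.sum_apply, Finset.sum_apply, cw_apply]

lemma linDiff_pd (c : Fin n → ℝ) (i : Fin n) (p) : linDiff c (pd i p) = pd i (linDiff c p) := by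
  simp only [linDiff, LinearMap.sum_apply, LinearMap.smul_apply, map_sum, map_smul]
  refine Finset.sum_congr rfl fun j _ => ?_
  have := LinearMap.congr_fun (pd_comm j i) p
  simp only [Module.End.mul_apply] at this
  rw [this]

lemma dd_cw (c : Fin n → ℝ) (f) : dd (cw (linDiff c) f) = cw (linDiff c) (dd f) := by
  funext τ
  simp only [dd_apply, cw_apply, map_sum, map_smul, linDiff_pd]

lemma dd_congr {f g : Finset (Fin n) → MvPolynomial (Fin n) ℝ} {p : ℕ}
    (h : ∀ τ, τ.card = p → f τ = g τ) (τ : Finset (Fin n)) (hτ : τ.card = p + 1) :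
    dd f τ = dd g τ := by
  rw [dd_apply, dd_apply]
  refine Finset.sum_congr rfl fun i hi => ?_
  rw [h]
  rw [Finset.card_erase_of_mem hi, hτ]; rfl

/-- Exactness of the `M`-valued de Rham complex at `p`-forms with coefficients in degree `m`. -/
def Ex (M : ℕ → Submodule ℝ (MvPolynomial (Fin n) ℝ)) (m p : ℕ) : Prop :=
  ∀ α : Finset (Fin n) → MvPolynomial (Fin n) ℝ, (∀ τ, τ.card = p → α τ ∈ M m) →
    (∀ τ, τ.card = p + 1 → dd α τ = 0) →
    ∃ β : Finset (Fin n) → MvPolynomial (Fin n) ℝ, (∀ τ, τ.card + 1 = p → β τ ∈ M (m + 1)) ∧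
      ∀ τ, τ.card = p → dd β τ = α τ

lemma Ex_step {M N : ℕ → Submodule ℝ (MvPolynomial (Fin n) ℝ)} (c : Fin n → ℝ)
    (hM : ∀ m i γ, γ ∈ M (m + 1) → pd i γ ∈ M m)
    (hN : ∀ m γ, γ ∈ N m ↔ γ ∈ M m ∧ linDiff c γ = 0) {m p : ℕ}
    (hs : ∀ γ ∈ M m, ∃ γ' ∈ M (m + 1), linDiff c γ' = γ)
    (h : Ex N m (p + 1)) : Ex M m p := by
  intro α hα hc
  have : ∀ τ : Finset (Fin n), ∃ g, τ.card = p → g ∈ M (m + 1) ∧ linDiff c g = α τ := by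
    intro τ
    by_cases hτ : τ.card = p
    · obtain ⟨g, h1, h2⟩ := hs _ (hα τ hτ)
      exact ⟨g, fun _ => ⟨h1, h2⟩⟩
    · exact ⟨0, fun h => absurd h hτ⟩
  choose η hη using this
  have hdη : ∀ τ, τ.card = p + 1 → dd η τ ∈ N m := by
    intro τ hτ
    rw [hN]
    constructor
    · rw [dd_apply]
      refine Submodule.sum_mem _ fun i hi => Submodule.smul_mem _ _ (hM _ _ _ (hη _ ?_).1)
      rw [Finset.card_erase_of_mem hi, hτ]; rfl
    · have h1 : linDiff c (dd η τ) = dd (cw (linDiff c) η) τ := by rw [dd_cw]; rfl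
      rw [h1, ← hc τ hτ]
      exact dd_congr (p := p) (fun τ hτ => (hη τ hτ).2) τ hτ
  obtain ⟨ζ, hζ, hζd⟩ := h (dd η) hdη (by
    intro τ _
    have := congrFun (LinearMap.congr_fun (dd_dd (n := n)) η) τ
    simpa using this)
  refine ⟨icon c (η - ζ), ?_, ?_⟩
  · intro τ hτ
    rw [icon_apply]
    refine Submodule.sum_mem _ fun i _ => Submodule.smul_mem _ _ ?_
    rw [iot_apply]
    split_ifs with hi
    · exact Submodule.zero_mem _
    · have hcard : (insert i τ).card = p := by rw [Finset.card_insert_of_notMem hi, hτ]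
      exact Submodule.smul_mem _ _ (Submodule.sub_mem _ (hη _ hcard).1
        ((hN _ _).1 (hζ _ (by rw [hcard]))).1)
  · intro τ hτ
    have h1 := congrFun (LinearMap.congr_fun (cartan c) (η - ζ)) τ
    simp only [LinearMap.add_apply, Module.End.mul_apply, Pi.add_apply, cw_apply] at h1
    have h2 : icon c (dd (η - ζ)) τ = 0 := by
      rw [icon_apply]
      refine Finset.sum_eq_zero fun i _ => ?_
      rw [iot_apply]
      split_ifs with hi
      · simp
      · have hcard : (insert i τ).card = p + 1 := by rw [Finset.card_insert_of_notMem hi, hτ]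
        rw [map_sub, Pi.sub_apply, hζd _ hcard]; simp
    rw [h2, zero_add] at h1
    rw [h1, Pi.sub_apply, map_sub, (hη τ hτ).2, ((hN _ _).1 (hζ τ (by rw [hτ]))).2, sub_zero]

end deRham

section stressLemmas

variable {n : ℕ}

lemma coeff_pd (i : Fin n) (p : MvPolynomial (Fin n) ℝ) (m : Fin n →₀ ℕ) :
    coeff m (pd i p) = coeff (m + Finsupp.single i 1) p * (m i + 1) := by
  simp only [pd, Derivation.coeFn_coe, coeff_pderiv]

lemma coeff_pd_pow (i : Fin n) (e : ℕ) : ∀ b : Fin n →₀ ℕ, ∃ r : ℝ, r ≠ 0 ∧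
    ∀ p, coeff b ((pd i ^ e) p) = r * coeff (b + Finsupp.single i e) p := by
  induction e with
  | zero => intro b; exact ⟨1, one_ne_zero, fun p => by simp⟩
  | succ e ih =>
    intro b
    obtain ⟨r, hr, h⟩ := ih b
    refine ⟨r * ((b + Finsupp.single i e : Fin n →₀ ℕ) i + 1), mul_ne_zero hr (by positivity), ?_⟩
    intro p
    rw [pow_succ, Module.End.mul_apply, h, coeff_pd, add_assoc, ← Finsupp.single_add]
    ring

lemma coeff_list (a : Fin n →₀ ℕ) (l : List (Fin n)) : ∀ b : Fin n →₀ ℕ, ∃ r : ℝ, r ≠ 0 ∧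
    ∀ p, coeff b ((l.map fun i => pd i ^ a i).prod p) =
      r * coeff (b + (l.map fun i => Finsupp.single i (a i)).sum) p := by
  induction l with
  | nil => intro b; exact ⟨1, one_ne_zero, fun p => by simp⟩
  | cons i l ih =>
    intro b
    obtain ⟨r, hr, h⟩ := coeff_pd_pow i (a i) b
    obtain ⟨r', hr', h'⟩ := ih (b + Finsupp.single i (a i))
    refine ⟨r * r', mul_ne_zero hr hr', fun p => ?_⟩
    rw [List.map_cons, List.prod_cons, Module.End.mul_apply, h, h', List.map_cons, List.sum_cons,
      add_assoc, mul_assoc]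

lemma coeff_monDiff (a b : Fin n →₀ ℕ) : ∃ r : ℝ, r ≠ 0 ∧
    ∀ p, coeff b (monDiff a p) = r * coeff (b + a) p := by
  obtain ⟨r, hr, h⟩ := coeff_list a (List.finRange n) b
  refine ⟨r, hr, fun p => ?_⟩
  rw [monDiff, h]
  congr 3
  rw [← List.ofFn_eq_map, List.sum_ofFn]
  exact Finsupp.univ_sum_single a

lemma mem_tStress {Δ : Set (Finset (Fin n))} (hΔ : IsComplex Δ) (p : MvPolynomial (Fin n) ℝ) :
    p ∈ tStress Δ ↔ ∀ a, coeff a p ≠ 0 → a.support ∈ Δ := by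
  simp only [tStress, Submodule.mem_iInf, LinearMap.mem_ker, Set.mem_ofPred_eq]
  constructor
  · intro h a ha
    by_contra hc
    obtain ⟨r, hr, h1⟩ := coeff_monDiff a 0
    have h2 := h1 p
    rw [h a hc, zero_add, coeff_zero] at h2
    exact mul_ne_zero hr ha h2.symm
  · intro h a ha
    ext b
    obtain ⟨r, hr, h1⟩ := coeff_monDiff a b
    rw [h1, coeff_zero]
    by_contra hc
    refine ha (hΔ _ (h _ (right_ne_zero_of_mul hc)) _ ?_)
    intro i hi
    simp only [Finsupp.mem_support_iff, Finsupp.add_apply] at hi ⊢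
    omega

lemma euler {m : ℕ} {p : MvPolynomial (Fin n) ℝ} (hp : p.IsHomogeneous m) :
    ∑ i, X i * pd i p = (m : ℝ) • p := by
  have := hp.sum_X_mul_pderiv
  rw [← Nat.cast_smul_eq_nsmul ℝ] at this
  exact this

lemma eq_zero_of_pd {m : ℕ} {p : MvPolynomial (Fin n) ℝ} (hp : p.IsHomogeneous (m + 1))
    (h : ∀ i, pd i p = 0) : p = 0 := by
  have := euler hp
  simp only [h, mul_zero, Finset.sum_const_zero] at this
  exact (smul_eq_zero.mp this.symm).resolve_left (by positivity)

lemma pd_homog {m : ℕ} {p : MvPolynomial (Fin n) ℝ} (hp : p.IsHomogeneous (m + 1)) (i : Fin n) :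
    (pd i p).IsHomogeneous m := hp.pderiv

lemma linDiff_homog {m : ℕ} {p : MvPolynomial (Fin n) ℝ} (hp : p.IsHomogeneous (m + 1))
    (c : Fin n → ℝ) : (linDiff c p).IsHomogeneous m := by
  rw [← mem_homogeneousSubmodule]
  simp only [linDiff, LinearMap.sum_apply, LinearMap.smul_apply]
  exact Submodule.sum_mem _ fun i _ => Submodule.smul_mem _ _ (pd_homog hp i)

/-- Poincare lemma for one-forms. -/
lemma poincare {m : ℕ} (g : Fin n → MvPolynomial (Fin n) ℝ) (hg : ∀ i, (g i).IsHomogeneous m)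
    (h : ∀ i j, pd i (g j) = pd j (g i)) :
    ∃ η : MvPolynomial (Fin n) ℝ, η.IsHomogeneous (m + 1) ∧ ∀ i, pd i η = g i := by
  refine ⟨((m : ℝ) + 1)⁻¹ • ∑ i, X i * g i, ?_, ?_⟩
  · rw [← mem_homogeneousSubmodule]
    refine Submodule.smul_mem _ _ (Submodule.sum_mem _ fun i _ => ?_)
    rw [mem_homogeneousSubmodule, add_comm]
    exact (isHomogeneous_X ℝ i).mul (hg i)
  · intro j
    rw [map_smul, map_sum]
    have h1 : ∀ i, pd j (X i * g i) = (if i = j then g j else 0) + X i * pd i (g j) := by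
      intro i
      rw [h i j]
      simp only [pd, Derivation.coeFn_coe, pderiv_mul, pderiv_X, Pi.single_apply]
      by_cases e : i = j
      · subst e; simp
      · have e' : ¬ j = i := fun x => e x.symm
        simp [e]
    simp only [h1, Finset.sum_add_distrib, Finset.sum_ite_eq', Finset.mem_univ, if_true]
    rw [euler (hg j)]
    have : g j + (m : ℝ) • g j = ((m : ℝ) + 1) • g j := by rw [add_smul, one_smul, add_comm]
    rw [this, smul_smul, inv_mul_cancel₀ (by positivity), one_smul]

lemma exists_missing {Δ : Set (Finset (Fin n))} (σ : Finset (Fin n)) (h : σ ∉ Δ) :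
    ∃ F ⊆ σ, IsMissingFace Δ F := by
  induction σ using Finset.strongInduction with
  | H σ ih =>
    by_cases hm : ∀ τ ⊂ σ, τ ∈ Δ
    · exact ⟨σ, subset_rfl, h, hm⟩
    · push Not at hm
      obtain ⟨τ, hτ, hn⟩ := hm
      obtain ⟨F, hF, hF'⟩ := ih τ hτ hn
      exact ⟨F, hF.trans hτ.subset, hF'⟩

/-- Condition (B): `S̃` is determined in high degree by its first derivatives. -/
lemma gen_tStress {Δ : Set (Finset (Fin n))} (hΔ : IsComplex Δ) {k m : ℕ}
    (hB : ∀ σ : Finset (Fin n), IsMissingFace Δ σ → σ.card ≤ k + 1) (hm : k + 1 ≤ m)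
    {p : MvPolynomial (Fin n) ℝ} (hp : p.IsHomogeneous (m + 1)) (h : ∀ i, pd i p ∈ tStress Δ) :
    p ∈ tStress Δ := by
  rw [mem_tStress hΔ]
  intro a ha
  by_contra hc
  obtain ⟨F, hF, hmF⟩ := exists_missing _ hc
  have hdeg : a.degree = m + 1 := by
    have := hp ha
    rw [Finsupp.degree_eq_weight_one]; exact this
  have : ∃ i, (if i ∈ F then 1 else 0) < a i := by
    by_contra hno
    push Not at hno
    have h1 : a.degree ≤ ∑ i, (if i ∈ F then 1 else 0) := by
      rw [Finsupp.degree_eq_sum]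
      exact Finset.sum_le_sum fun i _ => hno i
    have h2 := hB F hmF
    simp at h1
    omega
  obtain ⟨i, hi⟩ := this
  have hai : 1 ≤ a i := by omega
  obtain ⟨b, rfl⟩ : ∃ b, a = b + Finsupp.single i 1 := by
    refine ⟨a - Finsupp.single i 1, ?_⟩
    rw [tsub_add_cancel_of_le]
    simpa using hai
  have hb : b.support ∈ Δ := by
    refine (mem_tStress hΔ _).1 (h i) b ?_
    rw [coeff_pd]
    exact mul_ne_zero ha (by positivity)
  refine hmF.1 (hΔ _ hb _ ?_)
  intro j hj
  have := hF hj
  simp only [Finsupp.mem_support_iff, Finsupp.add_apply, Finsupp.single_apply] at this hi ⊢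
  by_cases e : i = j
  · subst e; simp [hj] at hi; omega
  · simpa [e] using this

lemma pd_tStress {Δ : Set (Finset (Fin n))} (hΔ : IsComplex Δ) (i : Fin n)
    {p : MvPolynomial (Fin n) ℝ} (hp : p ∈ tStress Δ) : pd i p ∈ tStress Δ := by
  rw [mem_tStress hΔ] at hp ⊢
  intro a ha
  rw [coeff_pd] at ha
  refine hΔ _ (hp _ (left_ne_zero_of_mul ha)) _ ?_
  intro j hj
  simp only [Finsupp.mem_support_iff, Finsupp.add_apply] at hj ⊢
  omega

end stressLemmas

section regularity

variable {n : ℕ}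

/-- Kernel modules of a sequence of linear differentials. -/
noncomputable def KM (Δ : Set (Finset (Fin n))) (y : ℕ → Fin n → ℝ) (j m : ℕ) :
    Submodule ℝ (MvPolynomial (Fin n) ℝ) :=
  tStressK Δ m ⊓ ⨅ l ∈ Finset.range j, LinearMap.ker (linDiff (y l))

lemma mem_KM {Δ : Set (Finset (Fin n))} {y : ℕ → Fin n → ℝ} {j m : ℕ} {p} :
    p ∈ KM Δ y j m ↔ p ∈ tStress Δ ∧ p.IsHomogeneous m ∧ ∀ l < j, linDiff (y l) p = 0 := by
  simp [KM, tStressK, Submodule.mem_iInf, and_assoc]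

lemma KM_succ {Δ : Set (Finset (Fin n))} {y : ℕ → Fin n → ℝ} {j : ℕ} (m : ℕ) (p) :
    p ∈ KM Δ y (j + 1) m ↔ p ∈ KM Δ y j m ∧ linDiff (y j) p = 0 := by
  simp only [mem_KM]
  constructor
  · rintro ⟨h1, h2, h3⟩
    exact ⟨⟨h1, h2, fun l hl => h3 l (by omega)⟩, h3 j (by omega)⟩
  · rintro ⟨⟨h1, h2, h3⟩, h4⟩
    refine ⟨h1, h2, fun l hl => ?_⟩
    rcases Nat.lt_succ_iff_lt_or_eq.1 hl with h | rfl
    · exact h3 l h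
    · exact h4

lemma KM_pd {Δ : Set (Finset (Fin n))} (hΔ : IsComplex Δ) {y : ℕ → Fin n → ℝ} {j : ℕ}
    (m : ℕ) (i : Fin n) (γ) (h : γ ∈ KM Δ y j (m + 1)) : pd i γ ∈ KM Δ y j m := by
  rw [mem_KM] at h ⊢
  refine ⟨pd_tStress hΔ i h.1, pd_homog h.2.1 i, fun l hl => ?_⟩
  rw [linDiff_pd, h.2.2 l hl, map_zero]

lemma KM_gen {Δ : Set (Finset (Fin n))} (hΔ : IsComplex Δ) {y : ℕ → Fin n → ℝ} {j k m : ℕ}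
    (hB : ∀ σ : Finset (Fin n), IsMissingFace Δ σ → σ.card ≤ k + 1) (hm : k + 1 ≤ m)
    {p : MvPolynomial (Fin n) ℝ} (hp : p.IsHomogeneous (m + 1)) (h : ∀ i, pd i p ∈ KM Δ y j m) :
    p ∈ KM Δ y j (m + 1) := by
  simp only [mem_KM] at h ⊢
  refine ⟨gen_tStress hΔ hB hm hp fun i => (h i).1, hp, fun l hl => ?_⟩
  obtain ⟨m, rfl⟩ : ∃ m', m = m' + 1 := ⟨m - 1, by omega⟩
  refine eq_zero_of_pd (linDiff_homog hp _) fun i => ?_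
  rw [← linDiff_pd, (h i).2.2 l hl]

/-- Surjectivity of `y_j` in degree `m`. -/
def Surj (Δ : Set (Finset (Fin n))) (y : ℕ → Fin n → ℝ) (j m : ℕ) : Prop :=
  ∀ γ ∈ KM Δ y j m, ∃ γ' ∈ KM Δ y j (m + 1), linDiff (y j) γ' = γ

lemma surj_step {Δ : Set (Finset (Fin n))} (hΔ : IsComplex Δ) {y : ℕ → Fin n → ℝ} {j k m : ℕ}
    (hB : ∀ σ : Finset (Fin n), IsMissingFace Δ σ → σ.card ≤ k + 1) (hm : k ≤ m)
    (hs : Surj Δ y j m) (hE : Ex (KM Δ y (j + 1)) m 2) : Surj Δ y j (m + 1) := by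
  intro γ hγ
  have h1 : ∀ i, ∃ g ∈ KM Δ y j (m + 1), linDiff (y j) g = pd i γ :=
    fun i => hs _ (KM_pd hΔ _ _ _ hγ)
  choose g hg hgy using h1
  set α : Finset (Fin n) → MvPolynomial (Fin n) ℝ := fun τ => ∑ i ∈ τ, g i with hα
  have hα1 : ∀ i, α {i} = g i := fun i => by simp [hα]
  have hαM : ∀ τ, α τ ∈ KM Δ y j (m + 1) := fun τ => Submodule.sum_mem _ fun i _ => hg i
  have key : ∀ τ : Finset (Fin n), τ.card = 2 → dd α τ ∈ KM Δ y (j + 1) m := by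
    intro τ hτ
    rw [KM_succ]
    constructor
    · rw [dd_apply]
      exact Submodule.sum_mem _ fun i _ => Submodule.smul_mem _ _ (KM_pd hΔ _ _ _ (hαM _))
    · have e1 : linDiff (y j) (dd α τ) = dd (cw (linDiff (y j)) α) τ := by rw [dd_cw]; rfl
      rw [e1]
      have e2 : dd (cw (linDiff (y j)) α) τ = dd (dd fun _ => γ) τ := by
        refine dd_congr (p := 1) (fun τ hτ => ?_) τ hτ
        obtain ⟨i, rfl⟩ := Finset.card_eq_one.1 hτ
        rw [cw_apply, hα1, hgy, dd_apply]
        simp [sg, Finset.filter_singleton]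
      rw [e2]
      have := congrFun (LinearMap.congr_fun (dd_dd (n := n)) fun _ => γ) τ
      simpa using this
  obtain ⟨β, hβ, hβd⟩ := hE (dd α) key (by
    intro τ _
    have := congrFun (LinearMap.congr_fun (dd_dd (n := n)) α) τ
    simpa using this)
  have hclosed : ∀ i j, i < j → pd i (α {j} - β {j}) = pd j (α {i} - β {i}) := by
    intro i j hij
    have h2 := hβd {i, j} (Finset.card_pair hij.ne)
    have h3 : dd (α - β) {i, j} = 0 := by rw [map_sub, Pi.sub_apply, h2, sub_self]
    rw [dd_apply, Finset.sum_pair hij.ne] at h3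
    have e1 : ({i, j} : Finset (Fin n)).erase i = {j} := by
      rw [Finset.erase_insert]; simpa using hij.ne
    have e2 : ({i, j} : Finset (Fin n)).erase j = {i} := by
      rw [Finset.pair_comm, Finset.erase_insert]; simpa using hij.ne'
    have s1 : sg i {i, j} = 1 := by
      rw [sg_insert_self]; simp [sg, Finset.filter_singleton, hij.not_gt]
    have s2 : sg j {i, j} = -1 := by
      rw [Finset.pair_comm, sg_insert_self]; simp [sg, Finset.filter_singleton, hij]
    rw [e1, e2, s1, s2, one_smul, neg_one_smul, ← sub_eq_add_neg, sub_eq_zero] at h3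
    exact h3
  have hβ1 : ∀ i, β {i} ∈ KM Δ y (j + 1) (m + 1) := fun i => hβ {i} rfl
  have hμ : ∀ i, α {i} - β {i} ∈ KM Δ y j (m + 1) := fun i =>
    Submodule.sub_mem _ (hαM _) ((KM_succ _ _).1 (hβ1 i)).1
  obtain ⟨η, hη, hηd⟩ := poincare (m := m + 1) (fun i => α {i} - β {i})
    (fun i => (mem_KM.1 (hμ i)).2.1) (by
      intro i j
      rcases lt_trichotomy i j with h | h | h
      · exact hclosed i j h
      · subst h; rfl
      · exact (hclosed j i h).symm)
  refine ⟨η, KM_gen hΔ hB (by omega) hη fun i => by rw [hηd]; exact hμ i, ?_⟩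
  rw [← sub_eq_zero]
  refine eq_zero_of_pd (m := m) ?_ fun i => ?_
  · rw [← mem_homogeneousSubmodule]
    exact Submodule.sub_mem _ (linDiff_homog hη _) (mem_KM.1 hγ).2.1
  · rw [map_sub, ← linDiff_pd, hηd, map_sub, hα1, hgy, ((KM_succ _ _).1 (hβ1 i)).2]
    simp

lemma main_reg {Δ : Set (Finset (Fin n))} (hΔ : IsComplex Δ) {y : ℕ → Fin n → ℝ} {D k : ℕ}
    (hB : ∀ σ : Finset (Fin n), IsMissingFace Δ σ → σ.card ≤ k + 1)
    (hC : ∀ j < D, ∀ m ≤ k, Surj Δ y j m)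
    (hA : ∀ γ ∈ KM Δ y D k, γ = 0) :
    ∀ e ≤ D, (∀ j, D ≤ j + e → j < D → ∀ m, Surj Δ y j m) ∧
      (∀ m p, k ≤ m → Ex (KM Δ y (D - e)) m p) := by
  have hA' : ∀ m, k ≤ m → ∀ γ ∈ KM Δ y D m, γ = 0 := by
    intro m hm
    induction m, hm using Nat.le_induction with
    | base => exact hA
    | succ m hm ih =>
      intro γ hγ
      exact eq_zero_of_pd (mem_KM.1 hγ).2.1 fun i => ih _ (KM_pd hΔ _ _ _ hγ)
  intro e
  induction e with
  | zero =>
    intro _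
    refine ⟨fun j h1 h2 => by omega, fun m p hm α hα _ => ?_⟩
    refine ⟨0, fun _ _ => Submodule.zero_mem _, fun τ hτ => ?_⟩
    rw [map_zero, hA' m hm _ (hα τ hτ)]; rfl
  | succ e ih =>
    intro he
    obtain ⟨ih1, ih2⟩ := ih (by omega)
    obtain ⟨j, hj⟩ : ∃ j, D = j + 1 + e := ⟨D - (e + 1), by omega⟩
    have hj1 : D - e = j + 1 := by omega
    have hj2 : D - (e + 1) = j := by omega
    rw [hj1] at ih2
    rw [hj2]
    have hS : ∀ m, Surj Δ y j m := by
      intro m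
      rcases le_or_gt m k with h | h
      · exact hC j (by omega) m h
      · induction m, h.le using Nat.le_induction with
        | base => exact hC j (by omega) _ le_rfl
        | succ m hm ihm =>
          refine surj_step hΔ hB hm ?_ (ih2 _ _ hm)
          rcases hm.eq_or_lt with h' | h'
          · subst h'; exact hC j (by omega) _ le_rfl
          · exact ihm h'
    refine ⟨fun i h1 h2 m => ?_, fun m p hm => ?_⟩
    · rcases Nat.lt_or_ge j i with h | h
      · exact ih1 i (by omega) h2 m
      · have : i = j := by omega
        subst this; exact hS m
    · exact Ex_step (y j) (KM_pd hΔ) (KM_succ) (hS m) (ih2 m (p + 1) hm)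

lemma main_ex {Δ : Set (Finset (Fin n))} (hΔ : IsComplex Δ) {y : ℕ → Fin n → ℝ} {D : ℕ}
    (hS : ∀ j < D, ∀ m, Surj Δ y j m) :
    ∀ e ≤ D, ∀ m p, n < p + e → Ex (KM Δ y (D - e)) m p := by
  intro e
  induction e with
  | zero =>
    intro _ m p hp α _ _
    refine ⟨0, fun _ _ => Submodule.zero_mem _, fun τ hτ => ?_⟩
    have := Finset.card_le_univ τ
    simp at this
    omega
  | succ e ih =>
    intro he m p hp
    obtain ⟨j, hj⟩ : ∃ j, D = j + 1 + e := ⟨D - (e + 1), by omega⟩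
    have hj1 : D - e = j + 1 := by omega
    have hj2 : D - (e + 1) = j := by omega
    have := ih (by omega) m (p + 1) (by omega)
    rw [hj1] at this
    rw [hj2]
    exact Ex_step (y j) (KM_pd hΔ) (KM_succ) (hS j (by omega) m) this

end regularity

section homology

variable {n : ℕ}

/-- The boundary operator on functions. -/
noncomputable def Bd : Module.End ℝ (Finset (Fin n) → ℝ) := ∑ i, iot i

lemma Bd_apply (f : Finset (Fin n) → ℝ) (τ) :
    Bd f τ = ∑ i, if i ∈ τ then 0 else sg i τ * f (insert i τ) := by
  simp [Bd, LinearMap.sum_apply, Finset.sum_apply, iot_apply]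

lemma bdry_eq (z : Finset (Fin n) →₀ ℝ) : ⇑(bdry z) = Bd ⇑z := by
  induction z using Finsupp.induction_linear with
  | zero => simp
  | add f g hf hg => rw [map_add, Finsupp.coe_add, hf, hg, Finsupp.coe_add, map_add]
  | single σ r =>
    funext τ
    rw [Bd_apply]
    simp only [bdry, Finsupp.lsum_single, LinearMap.toSpanSingleton_apply, Finsupp.smul_apply,
      Finsupp.finsetSum_apply, smul_eq_mul, Finsupp.single_apply]
    rw [Finset.mul_sum, ← Finset.sum_subset (Finset.subset_univ σ)]
    · refine Finset.sum_congr rfl fun i hi => ?_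
      by_cases h : σ.erase i = τ
      · have h1 : i ∉ τ := by rw [← h]; simp
        have h2 : σ = insert i τ := by rw [← h, Finset.insert_erase hi]
        rw [if_pos h, if_neg h1, if_pos h2, ← sg_insert_self i τ, ← h2]
        unfold sg; ring
      · rw [if_neg h]
        by_cases h1 : i ∈ τ
        · simp [h1]
        · have h2 : ¬ σ = insert i τ := by
            rintro rfl
            exact h (Finset.erase_insert h1)
          simp [h2]
    · intro i _ hi
      have h2 : ¬ σ = insert i τ := by
        rintro rfl
        simp at hi
      simp [h2]

/-- Vanishing of the homology of `Γ_W` at faces of cardinality `q`. -/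
def HV (Γ : Set (Finset (Fin n))) (W : Finset (Fin n)) (q : ℕ) : Prop :=
  ∀ z : Finset (Fin n) → ℝ, (∀ ρ, z ρ ≠ 0 → ρ ∈ Γ ∧ ρ ⊆ W ∧ ρ.card = q) → Bd z = 0 →
    ∃ c : Finset (Fin n) → ℝ, (∀ ρ, c ρ ≠ 0 → ρ ∈ Γ ∧ ρ ⊆ W ∧ ρ.card = q + 1) ∧ Bd c = z

lemma Bd_eps (v : Fin n) (z : Finset (Fin n) → ℝ) : Bd (eps v z) = z - eps v (Bd z) := by
  have h : (Bd * eps v + eps v * Bd : Module.End ℝ (Finset (Fin n) → ℝ)) = 1 := by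
    rw [Bd, Finset.sum_mul, Finset.mul_sum, ← Finset.sum_add_distrib]
    simp only [iot_eps]
    simp
  have := LinearMap.congr_fun h z
  simp only [LinearMap.add_apply, Module.End.mul_apply, Module.End.one_apply] at this
  exact eq_sub_of_add_eq this

lemma iot_Bd (v : Fin n) (z : Finset (Fin n) → ℝ) : iot v (Bd z) = - Bd (iot v z) := by
  have h : (iot v * Bd : Module.End ℝ (Finset (Fin n) → ℝ)) = - (Bd * iot v) := by
    rw [Bd, Finset.sum_mul, Finset.mul_sum, ← Finset.sum_neg_distrib]
    exact Finset.sum_congr rfl fun i _ => iot_iot v i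
  exact LinearMap.congr_fun h z

lemma HV_link {Δ : Set (Finset (Fin n))} (hΔ : IsComplex Δ) {σ W : Finset (Fin n)} {v : Fin n}
    (hvσ : v ∉ σ) (hvW : v ∉ W) {q : ℕ} (h1 : HV (lk Δ σ) W q)
    (h2 : HV (lk Δ σ) (insert v W) (q + 1)) : HV (lk Δ (insert v σ)) W q := by
  have l1 : ∀ ρ, ρ ∈ lk Δ (insert v σ) → ρ ∈ lk Δ σ := by
    rintro ρ ⟨ha, hb⟩
    refine ⟨Finset.disjoint_of_subset_left (Finset.subset_insert _ _) ha, hΔ _ hb _ ?_⟩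
    exact Finset.union_subset_union_left (Finset.subset_insert _ _)
  have l2 : ∀ ρ, v ∉ ρ → (ρ ∈ lk Δ (insert v σ) ↔ insert v ρ ∈ lk Δ σ) := by
    intro ρ hv
    have e : insert v σ ∪ ρ = σ ∪ insert v ρ := by
      rw [Finset.insert_union, Finset.union_insert]
    have e' : Disjoint (insert v σ) ρ ↔ Disjoint σ (insert v ρ) := by
      rw [Finset.disjoint_insert_left, Finset.disjoint_insert_right]
      simp [hv, hvσ]
    change (_ ∧ _) ↔ (_ ∧ _)
    rw [e, e']
  intro z hz hBz
  obtain ⟨c, hc, hcz⟩ := h1 z (fun ρ h => ⟨l1 _ (hz ρ h).1, (hz ρ h).2⟩) hBz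
  obtain ⟨e, he, heu⟩ := h2 (eps v z - c) (by
    intro ρ hρ
    by_cases hcρ : c ρ = 0
    · rw [Pi.sub_apply, hcρ, sub_zero, eps_apply] at hρ
      split_ifs at hρ with hv
      · have := hz _ (right_ne_zero_of_mul hρ)
        have hi := Finset.insert_erase hv
        refine ⟨?_, ?_, ?_⟩
        · rw [← hi, ← l2 _ (Finset.notMem_erase _ _)]; exact this.1
        · rw [← hi]; exact Finset.insert_subset_insert _ this.2.1
        · rw [← hi, Finset.card_insert_of_notMem (Finset.notMem_erase _ _), this.2.2]
      · exact absurd rfl hρ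
    · have := hc ρ hcρ
      exact ⟨this.1, this.2.1.trans (Finset.subset_insert _ _), this.2.2⟩) (by
    rw [map_sub, Bd_eps, hBz, hcz]; simp)
  refine ⟨- iot v e, ?_, ?_⟩
  · intro ρ hρ
    rw [Pi.neg_apply, neg_ne_zero, iot_apply] at hρ
    split_ifs at hρ with hv
    · exact absurd rfl hρ
    · have := he _ (right_ne_zero_of_mul hρ)
      refine ⟨(l2 ρ hv).2 this.1, ?_, ?_⟩
      · intro x hx
        have hx' := this.2.1 (Finset.mem_insert_of_mem hx)
        rcases Finset.mem_insert.1 hx' with rfl | h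
        · exact absurd hx hv
        · exact h
      · have := this.2.2
        rw [Finset.card_insert_of_notMem hv] at this
        omega
  · rw [map_neg, ← iot_Bd, heu]
    funext ρ
    rw [iot_apply]
    split_ifs with hv
    · by_contra hne
      exact hvW ((hz ρ (fun h => hne h.symm)).2.1 hv)
    · have hc0 : c (insert v ρ) = 0 := by
        by_contra hne
        exact hvW ((hc _ hne).2.1 (Finset.mem_insert_self _ _))
      rw [Pi.sub_apply, hc0, eps_apply, if_pos (Finset.mem_insert_self _ _),
        Finset.erase_insert hv, sg_insert_self, sub_zero, smul_smul, sg_sq, one_smul]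

lemma HV_links {Δ : Set (Finset (Fin n))} (hΔ : IsComplex Δ) {D : ℕ}
    (h : ∀ W q, q + n < W.card + D → HV Δ W q) (σ : Finset (Fin n)) :
    ∀ W, Disjoint σ W → ∀ q, q + n < W.card + D → HV (lk Δ σ) W q := by
  induction σ using Finset.induction_on with
  | empty =>
    intro W _ q hq
    have : lk Δ ∅ = Δ := by ext τ; simp [lk]
    rw [this]
    exact h W q hq
  | insert v σ hv ih =>
    intro W hW q hq
    rw [Finset.disjoint_insert_left] at hW
    refine HV_link hΔ hv hW.1 (ih W hW.2 q hq) (ih _ ?_ _ ?_)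
    · rw [Finset.disjoint_insert_right]; exact ⟨hv, hW.2⟩
    · rw [Finset.card_insert_of_notMem hW.1]; omega

/-- The exponent vector of a squarefree monomial. -/
noncomputable def ind (ρ : Finset (Fin n)) : Fin n →₀ ℕ :=
  Finsupp.equivFunOnFinite.symm fun i => if i ∈ ρ then 1 else 0

lemma ind_apply (ρ : Finset (Fin n)) (i) : ind ρ i = if i ∈ ρ then 1 else 0 := rfl

lemma ind_insert {ρ : Finset (Fin n)} {i} (h : i ∉ ρ) :
    ind (insert i ρ) = ind ρ + Finsupp.single i 1 := by
  ext j
  simp only [ind_apply, Finsupp.add_apply, Finsupp.single_apply, Finset.mem_insert]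
  by_cases e : i = j
  · subst e; simp [h]
  · have e' : ¬ j = i := fun x => e x.symm
    simp [e, e']

lemma ind_support (ρ : Finset (Fin n)) : (ind ρ).support = ρ := by
  ext i; simp [ind_apply]

lemma ind_degree (ρ : Finset (Fin n)) : (ind ρ).degree = ρ.card := by
  rw [Finsupp.degree_eq_sum]; simp [ind_apply]

/-- sign correction -/
noncomputable def tw (W τ : Finset (Fin n)) : ℝ := ∏ i ∈ τ, sg i W

lemma tw_sq (W τ : Finset (Fin n)) : tw W τ * tw W τ = 1 := by
  rw [tw, ← Finset.prod_mul_distrib]; simp [sg_sq]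

lemma tw_key {W τ : Finset (Fin n)} (h : τ ⊆ W) {i : Fin n} (hi : i ∈ τ) :
    sg i τ * tw W (τ.erase i) = tw W τ * sg i (W \ τ) := by
  have h1 : tw W τ = sg i W * tw W (τ.erase i) := (Finset.mul_prod_erase τ _ hi).symm
  rw [h1, ← sg_union i W τ h]
  have := sg_sq i (W \ τ)
  linear_combination (-(sg i τ * tw W (τ.erase i))) * this

lemma hoch_sum {W τ : Finset (Fin n)} (h : τ ⊆ W) (c : Finset (Fin n) → ℝ)
    (hc : ∀ ρ, c ρ ≠ 0 → ρ ⊆ W) :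
    ∑ i ∈ τ, sg i τ * (tw W (τ.erase i) * c (insert i (W \ τ))) = tw W τ * Bd c (W \ τ) := by
  rw [Bd_apply, Finset.mul_sum, ← Finset.sum_subset (Finset.subset_univ τ)]
  · refine Finset.sum_congr rfl fun i hi => ?_
    have : i ∉ W \ τ := by simp [hi]
    rw [if_neg this, ← mul_assoc, tw_key h hi, mul_assoc]
  · intro i _ hi
    split_ifs with hiW
    · simp
    · have : c (insert i (W \ τ)) = 0 := by
        by_contra hne
        have := hc _ hne (Finset.mem_insert_self _ _)
        exact hiW (Finset.mem_sdiff.2 ⟨this, hi⟩)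
      simp [this]

lemma pd_monomial_ind_insert {ρ : Finset (Fin n)} {i} (h : i ∉ ρ) (r : ℝ) :
    pd i (monomial (ind (insert i ρ)) r) = monomial (ind ρ) r := by
  simp only [pd, Derivation.coeFn_coe, pderiv_monomial]
  rw [ind_insert h]
  simp [ind_apply, h]

lemma pd_monomial_ind_notMem {ρ : Finset (Fin n)} {i} (h : i ∉ ρ) (r : ℝ) :
    pd i (monomial (ind ρ) r) = 0 := by
  simp only [pd, Derivation.coeFn_coe, pderiv_monomial]
  simp [ind_apply, h]

lemma hochster {Δ : Set (Finset (Fin n))} (hΔ : IsComplex Δ) {y : ℕ → Fin n → ℝ} {D : ℕ}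
    (hE : ∀ m p, n < p + D → Ex (KM Δ y 0) m p) (W : Finset (Fin n)) (q : ℕ)
    (hq : q + n < W.card + D) : HV Δ W q := by
  intro z hz hBz
  by_cases hqW : q ≤ W.card
  swap
  · refine ⟨0, fun ρ h => absurd rfl h, ?_⟩
    rw [map_zero]
    funext ρ
    by_contra hne
    have := hz ρ (fun h => hne h.symm)
    have h2 := Finset.card_le_card this.2.1
    omega
  set α : Finset (Fin n) → MvPolynomial (Fin n) ℝ := fun τ =>
    if τ ⊆ W then monomial (ind (W \ τ)) (tw W τ * z (W \ τ)) else 0 with hα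
  obtain ⟨p, hp⟩ : ∃ p, W.card = p + q := ⟨W.card - q, by omega⟩
  obtain ⟨η, hη, hηd⟩ := hE q p (by omega) α (by
    intro τ hτ
    rw [hα]
    dsimp only
    split_ifs with hτW
    · by_cases hz0 : z (W \ τ) = 0
      · rw [hz0]; simp
      · rw [mem_KM]
        refine ⟨?_, ?_, fun l hl => by omega⟩
        · rw [mem_tStress hΔ]
          intro a ha
          rw [coeff_monomial] at ha
          split_ifs at ha with e
          · rw [← e, ind_support]; exact (hz _ hz0).1
          · exact absurd rfl ha
        · exact isHomogeneous_monomial _ (by rw [ind_degree]; exact (hz _ hz0).2.2)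
    · exact Submodule.zero_mem _) (by
    intro τ hτ
    rw [dd_apply]
    by_cases hτW : τ ⊆ W
    · have h1 : ∀ i ∈ τ, sg i τ • pd i (α (τ.erase i)) =
          monomial (ind (W \ τ)) (sg i τ * (tw W (τ.erase i) * z (insert i (W \ τ)))) := by
        intro i hi
        have e1 : τ.erase i ⊆ W := (Finset.erase_subset _ _).trans hτW
        have e2 : W \ τ.erase i = insert i (W \ τ) := by
          rw [Finset.sdiff_erase (hτW hi)]
        rw [hα]
        dsimp only
        rw [if_pos e1, e2, pd_monomial_ind_insert (by simp [hi]), smul_monomial, smul_eq_mul]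
      rw [Finset.sum_congr rfl h1, ← map_sum, hoch_sum hτW z (fun ρ h => (hz ρ h).2.1), hBz]
      simp
    · refine Finset.sum_eq_zero fun i hi => ?_
      rw [hα]
      dsimp only
      split_ifs with h1
      · have hiW : i ∉ W := by
          intro hiW
          apply hτW
          rw [← Finset.insert_erase hi]
          exact Finset.insert_subset hiW h1
        rw [pd_monomial_ind_notMem (by simp [hiW]), smul_zero]
      · simp)
  set c : Finset (Fin n) → ℝ := fun ρ =>
    if ρ ⊆ W ∧ ρ.card = q + 1 then tw W (W \ ρ) * coeff (ind ρ) (η (W \ ρ)) else 0 with hcdef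
  have hc : ∀ ρ, c ρ ≠ 0 → ρ ∈ Δ ∧ ρ ⊆ W ∧ ρ.card = q + 1 := by
    intro ρ hρ
    rw [hcdef] at hρ
    dsimp only at hρ
    split_ifs at hρ with h
    · refine ⟨?_, h⟩
      have hle := Finset.card_le_card h.1
      have h1 := hη (W \ ρ) (by rw [Finset.card_sdiff_of_subset h.1]; omega)
      have := (mem_tStress hΔ _).1 (mem_KM.1 h1).1 _ (right_ne_zero_of_mul hρ)
      rwa [ind_support] at this
    · exact absurd rfl hρ
  refine ⟨c, hc, ?_⟩
  funext ρ
  by_cases hρ : ρ ⊆ W ∧ ρ.card = q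
  · obtain ⟨hρW, hρq⟩ := hρ
    set τ := W \ ρ with hτ
    have hτW : τ ⊆ W := Finset.sdiff_subset
    have hWτ : W \ τ = ρ := Finset.sdiff_sdiff_eq_self hρW
    have h1 := hoch_sum hτW c (fun ρ h => (hc ρ h).2.1)
    rw [hWτ] at h1
    have h2 := hηd τ (by rw [hτ, Finset.card_sdiff_of_subset hρW]; omega)
    have h3 : coeff (ind ρ) (dd η τ) = tw W τ * z ρ := by
      rw [h2, hα]
      dsimp only
      rw [if_pos hτW, hWτ, coeff_monomial, if_pos rfl]
    have h4 : coeff (ind ρ) (dd η τ) =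
        ∑ i ∈ τ, sg i τ * (tw W (τ.erase i) * c (insert i ρ)) := by
      rw [dd_apply, coeff_sum]
      refine Finset.sum_congr rfl fun i hi => ?_
      have hiρ : i ∉ ρ := (Finset.mem_sdiff.1 hi).2
      have e1 : W \ insert i ρ = τ.erase i := by
        rw [hτ, Finset.sdiff_insert]
      rw [coeff_smul, coeff_pd, ← ind_insert hiρ, smul_eq_mul, hcdef]
      dsimp only
      rw [if_pos ⟨Finset.insert_subset (hτW hi) hρW, by
        rw [Finset.card_insert_of_notMem hiρ, hρq]⟩, e1, ← mul_assoc (tw W _), tw_sq]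
      simp [ind_apply, hiρ]
    rw [← h4, h3] at h1
    have h5 := tw_sq W τ
    have h6 : tw W τ ≠ 0 := by
      intro h; rw [h] at h5; simp at h5
    exact (mul_left_cancel₀ h6 h1).symm
  · have hz0 : z ρ = 0 := by
      by_contra hne
      exact hρ (hz ρ hne).2
    rw [hz0, Bd_apply]
    refine Finset.sum_eq_zero fun i _ => ?_
    split_ifs with hi
    · rfl
    · have : c (insert i ρ) = 0 := by
        by_contra hne
        obtain ⟨_, h1, h2⟩ := hc _ hne
        rw [Finset.card_insert_of_notMem hi] at h2
        exact hρ ⟨(Finset.subset_insert _ _).trans h1, by omega⟩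
      simp [this]

lemma cm_of_HV {Δ : Set (Finset (Fin n))} (hΔ : IsComplex Δ) {D : ℕ} (hD : dim1 Δ ≤ D)
    (h : ∀ W q, q + n < W.card + D → HV Δ W q) : IsCM Δ := by
  intro σ hσ i hi z hz
  obtain ⟨hz1, hz2⟩ := Submodule.mem_inf.1 hz
  rw [chains, Finsupp.mem_supported] at hz1
  have hz3 : ∀ ρ, z ρ ≠ 0 → ρ ∈ lk Δ σ ∧ (ρ.card : ℤ) = i + 1 := fun ρ hρ =>
    hz1 (Finsupp.mem_support_iff.2 hρ)
  by_cases hneg : i + 1 < 0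
  · have : z = 0 := by
      ext ρ
      by_contra hne
      have := (hz3 ρ hne).2
      omega
    rw [this]; exact Submodule.zero_mem _
  obtain ⟨q, hq⟩ : ∃ q : ℕ, (q : ℤ) = i + 1 := ⟨(i + 1).toNat, by omega⟩
  have hcard : σᶜ.card + σ.card = n := by
    rw [Finset.card_compl_add_card]; simp
  obtain ⟨c, hc, hcz⟩ := HV_links hΔ h σ σᶜ disjoint_compl_right q (by omega) z (by
    intro ρ hρ
    obtain ⟨h1, h2⟩ := hz3 ρ hρ
    refine ⟨h1, ?_, by omega⟩
    rw [Finset.subset_compl_iff_disjoint_left]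
    exact h1.1) (by
    rw [← bdry_eq, LinearMap.mem_ker.1 hz2]; rfl)
  refine ⟨Finsupp.equivFunOnFinite.symm c, ?_, ?_⟩
  · change _ ∈ chains _ _
    rw [chains, Finsupp.mem_supported]
    intro ρ hρ
    have := hc ρ (by simpa using hρ)
    exact ⟨this.1, by omega⟩
  · apply DFunLike.coe_injective
    rw [bdry_eq, ← hcz]
    rfl

/-- The dimension bound. -/
lemma dim_le {Δ : Set (Finset (Fin n))} (hΔ : IsComplex Δ) {y : ℕ → Fin n → ℝ} {D k : ℕ}
    (hA : ∀ γ ∈ KM Δ y D k, γ = 0) (σ : Finset (Fin n)) (hσ : σ ∈ Δ) : σ.card ≤ D := by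
  by_contra hlt
  push Not at hlt
  let f : (σ → ℝ) →ₗ[ℝ] (Fin D → ℝ) :=
    LinearMap.pi fun l => ∑ i : σ, y l i.1 • LinearMap.proj i
  obtain ⟨w, hw0, hw⟩ : ∃ w, w ≠ 0 ∧ f w = 0 := by
    have : ¬ Function.Injective f := by
      intro hinj
      have := LinearMap.finrank_le_finrank_of_injective hinj
      simp at this
      omega
    rw [← LinearMap.ker_eq_bot] at this
    obtain ⟨w, hw, hw0⟩ := (Submodule.ne_bot_iff _).1 this
    exact ⟨w, hw0, hw⟩
  set ℓ : MvPolynomial (Fin n) ℝ := ∑ i : σ, C (w i) * X i.1 with hℓ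
  have hpd : ∀ j, pd j ℓ = C (if h : j ∈ σ then w ⟨j, h⟩ else 0) := by
    intro j
    simp only [hℓ, map_sum, pd, Derivation.coeFn_coe, pderiv_C_mul, pderiv_X, Pi.single_apply]
    split_ifs with h
    · rw [Finset.sum_eq_single ⟨j, h⟩]
      · simp
      · intro b _ hb
        have : ¬ b.1 = j := fun e => hb (Subtype.ext e)
        simp [this]
      · simp
    · rw [map_zero]
      refine Finset.sum_eq_zero fun b _ => ?_
      have : ¬ b.1 = j := fun e => h (e ▸ b.2)
      simp [this]
  have hlin : ∀ l < D, linDiff (y l) ℓ = 0 := by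
    intro l hl
    have h1 := congrFun hw ⟨l, hl⟩
    simp only [f, LinearMap.pi_apply, LinearMap.sum_apply, LinearMap.smul_apply,
      LinearMap.proj_apply, smul_eq_mul, Pi.zero_apply] at h1
    simp only [hℓ, map_sum]
    have h2 : ∀ i : σ, linDiff (y l) (C (w i) * X i.1) = C (y l i.1 * w i) := by
      intro i
      simp only [linDiff, LinearMap.sum_apply, LinearMap.smul_apply, pd, Derivation.coeFn_coe,
        pderiv_C_mul, pderiv_X, Pi.single_apply]
      rw [Finset.sum_eq_single i.1]
      · simp [smul_eq_C_mul]
      · intro b _ hb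
        simp [hb.symm]
      · simp
    simp only [h2, ← map_sum, h1, map_zero]
  have hℓ0 : ℓ ≠ 0 := by
    intro h0
    apply hw0
    ext i
    have := hpd i.1
    rw [h0, map_zero, dif_pos i.2] at this
    exact (C_eq_zero.1 this.symm)
  refine pow_ne_zero k hℓ0 (hA _ ?_)
  rw [mem_KM]
  refine ⟨?_, ?_, ?_⟩
  · rw [mem_tStress hΔ]
    intro a ha
    refine hΔ σ hσ _ ?_
    have hv : (ℓ ^ k).vars ⊆ σ := by
      refine (vars_pow _ _).trans ?_
      rw [hℓ]
      refine (vars_sum_subset _ _).trans ?_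
      intro x hx
      obtain ⟨i, _, hi⟩ := Finset.mem_biUnion.1 hx
      have := vars_mul _ _ hi
      simp at this
      rw [this]; exact i.2
    intro x hx
    exact hv ((mem_vars_iff_mem_support x).2 ⟨a, mem_support_iff.2 ha, hx⟩)
  · have : ℓ.IsHomogeneous 1 := by
      rw [hℓ]
      refine IsHomogeneous.sum _ _ _ fun i _ => ?_
      exact isHomogeneous_C_mul_X _ _
    simpa using this.pow k
  · intro l hl
    have : linDiff (y l) (ℓ ^ k) = (k : MvPolynomial (Fin n) ℝ) * ℓ ^ (k - 1) * linDiff (y l) ℓ := by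
      simp only [linDiff, LinearMap.sum_apply, LinearMap.smul_apply, pd, Derivation.coeFn_coe,
        pderiv_pow, Finset.mul_sum, mul_smul_comm]
    rw [this, hlin l hl, mul_zero]

end homology

theorem stmt9 {n d : ℕ} (V : Fin n → Fin d → ℝ) (Δ : Set (Finset (Fin n)))
    (hΔ : IsComplex Δ) (hp : IsProper V Δ) (c : Fin n → ℝ) (k : ℕ)
    (hA : ToricChordal V Δ (linDiff c) k)
    (hB : ∀ σ : Finset (Fin n), IsMissingFace Δ σ → σ.card ≤ k + 1)
    (hC : RegularUpTo Δ ((List.ofFn fun j : Fin d => coordDiff V j) ++ [linDiff c]) k) :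
    (∀ k' : ℕ, RegularUpTo Δ ((List.ofFn fun j : Fin d => coordDiff V j) ++ [linDiff c]) k') ∧
    IsCM Δ := by
  set θ := (List.ofFn fun j : Fin d => coordDiff V j) ++ [linDiff c] with hθ
  have hlen : θ.length = d + 1 := by simp [hθ]
  have hget1 : ∀ j : Fin d, θ.getD j 0 = coordDiff V j := by
    intro j
    rw [hθ, List.getD_append _ _ _ _ (by simp)]
    simp [List.getD_eq_getElem?_getD]
  have hget2 : θ.getD d 0 = linDiff c := by
    rw [hθ, List.getD_append_right _ _ _ _ (by simp)]
    simp
  have hex : ∀ l, ∃ c', l < d + 1 → θ.getD l 0 = linDiff c' := by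
    intro l
    rcases lt_trichotomy l d with h | h | h
    · exact ⟨fun i => V i ⟨l, h⟩, fun _ => hget1 ⟨l, h⟩⟩
    · exact ⟨c, fun _ => by rw [h, hget2]⟩
    · exact ⟨0, fun h' => by omega⟩
  choose y hy using hex
  have hKM : ∀ j ≤ d + 1, ∀ m,
      tStressK Δ m ⊓ ⨅ l ∈ Finset.range j, LinearMap.ker (θ.getD l 0) = KM Δ y j m := by
    intro j hj m
    rw [KM]
    congr 1
    refine iInf_congr fun l => iInf_congr fun hl => ?_
    rw [hy l (by have := Finset.mem_range.1 hl; omega)]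
  have hreg : ∀ k', RegularUpTo Δ θ k' ↔ ∀ j < d + 1, ∀ m ≤ k', Surj Δ y j m := by
    intro k'
    unfold RegularUpTo Surj
    rw [hlen]
    refine forall_congr' fun j => forall_congr' fun hj => forall_congr' fun m =>
      forall_congr' fun hm => ?_
    rw [hKM j (by omega), hKM j (by omega), hy j hj]
  have hA' : ∀ γ ∈ KM Δ y (d + 1) k, γ = 0 := by
    intro γ hγ
    obtain ⟨h1, h2, h3⟩ := mem_KM.1 hγ
    refine hA.2 γ ?_ ?_
    · refine Submodule.mem_inf.2 ⟨Submodule.mem_inf.2 ⟨h1, ?_⟩, h2⟩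
      simp only [Submodule.mem_iInf, LinearMap.mem_ker]
      intro j
      rw [← hget1 j, hy j (by omega)]
      exact h3 j (by omega)
    · rw [← hget2, hy d (by omega)]
      exact h3 d (by omega)
  have hS : ∀ j < d + 1, ∀ m, Surj Δ y j m := fun j hj =>
    (main_reg hΔ hB ((hreg k).1 hC) hA' (d + 1) le_rfl).1 j (by omega) hj
  refine ⟨fun k' => (hreg k').2 fun j hj m _ => hS j hj m, ?_⟩
  have hE : ∀ m p, n < p + (d + 1) → Ex (KM Δ y 0) m p := by
    intro m p hp'
    have := main_ex hΔ hS (d + 1) le_rfl m p hp'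
    rwa [Nat.sub_self] at this
  refine cm_of_HV hΔ (D := d + 1) ?_ (hochster hΔ hE)
  refine csSup_le' ?_
  rintro m ⟨σ, hσ, rfl⟩
  exact dim_le hΔ hA' σ hσ
end

section
/- (Partition of unity for shellable complexes) Let Δ be a proper geometric shellable (d−1)-dimensional simplicial complex in ℝ^d. Then for every k < d, the stress space S_k(Δ) is spanned by the stress spaces of vertex stars: the natural map ⊕_{v ∈ Δ^(0)} S_k(St_v Δ) → S_k(Δ), given by the inclusions S_k(St_v Δ) ⊆ S_k(Δ), is surjective. -/
open MvPolynomial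

open MvPolynomial

namespace Shell

variable {n d : ℕ}

/-- Exponential-type coefficient. -/
noncomputable def fac (e : Fin n →₀ ℕ) : ℝ := ∏ i, ((e i).factorial : ℝ)

lemma fac_ne (e : Fin n →₀ ℕ) : fac e ≠ 0 := by
  unfold fac
  exact Finset.prod_ne_zero_iff.2 fun i _ => by positivity

lemma fac_succ (e : Fin n →₀ ℕ) (i : Fin n) :
    fac (e + Finsupp.single i 1) = ((e i : ℝ) + 1) * fac e := by
  unfold fac
  rw [← Finset.mul_prod_erase _ _ (Finset.mem_univ i),
    ← Finset.mul_prod_erase (a := i) _ (fun j => ((e j).factorial : ℝ)) (Finset.mem_univ i), ← mul_assoc]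
  congr 1
  · simp [Nat.factorial_succ]
  · apply Finset.prod_congr rfl
    intro j hj
    have : i ≠ j := (Finset.ne_of_mem_erase hj).symm
    simp [Finsupp.single_apply, this]

noncomputable def N : MvPolynomial (Fin n) ℝ →ₗ[ℝ] ((Fin n →₀ ℕ) → ℝ) where
  toFun s e := coeff e s * fac e
  map_add' s t := by ext e; simp [add_mul]
  map_smul' r s := by ext e; simp [mul_assoc]

lemma N_apply (s : MvPolynomial (Fin n) ℝ) (e) : N s e = coeff e s * fac e := rfl

lemma N_inj {s t : MvPolynomial (Fin n) ℝ} (h : N s = N t) : s = t := by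
  ext e
  have := congrFun h e
  rw [N_apply, N_apply] at this
  exact mul_right_cancel₀ (fac_ne e) this

lemma N_pd (i : Fin n) (s : MvPolynomial (Fin n) ℝ) (e) :
    N (pd i s) e = N s (e + Finsupp.single i 1) := by
  rw [N_apply, N_apply, fac_succ]
  simp only [pd, Derivation.coeFn_coe, coeff_pderiv]
  ring

lemma N_pd_pow (i : Fin n) (m : ℕ) (s : MvPolynomial (Fin n) ℝ) (e) :
    N ((pd i ^ m) s) e = N s (e + Finsupp.single i m) := by
  induction m generalizing e with
  | zero => simp
  | succ m ih =>
    rw [pow_succ', Module.End.mul_apply, N_pd, ih, add_assoc, ← Finsupp.single_add, add_comm 1 m]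

lemma N_list (a : Fin n →₀ ℕ) (l : List (Fin n)) (s : MvPolynomial (Fin n) ℝ) (e) :
    N ((l.map fun i => pd i ^ a i).prod s) e
      = N s (e + (l.map fun i => Finsupp.single i (a i)).sum) := by
  induction l generalizing e with
  | nil => simp
  | cons i l ih =>
    rw [List.map_cons, List.prod_cons, Module.End.mul_apply, N_pd_pow, ih, List.map_cons,
      List.sum_cons, add_assoc]

lemma N_monDiff (a : Fin n →₀ ℕ) (s : MvPolynomial (Fin n) ℝ) (e) :
    N (monDiff a s) e = N s (e + a) := by
  unfold monDiff
  rw [N_list]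
  congr 2
  have h : (List.map (fun i => Finsupp.single i (a i)) (List.finRange n)).sum
      = ∑ i, Finsupp.single i (a i) := by
    rw [← List.ofFn_eq_map, List.sum_ofFn]
  rw [h, Finsupp.univ_sum_single a]

/-- Stress space in terms of exponential coefficients. -/
def W (V : Fin n → Fin d → ℝ) (Δ : Set (Finset (Fin n))) (k : ℕ) :
    Submodule ℝ ((Fin n →₀ ℕ) → ℝ) where
  carrier := {f | (∀ e, e.support ∉ Δ → f e = 0) ∧ (∀ e, e.degree ≠ k → f e = 0) ∧
    ∀ e, ∑ i, f (e + Finsupp.single i 1) • V i = 0}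
  zero_mem' := by simp
  add_mem' := by
    rintro f g ⟨h1, h2, h3⟩ ⟨h1', h2', h3'⟩
    refine ⟨fun e he => by simp [h1 e he, h1' e he], fun e he => by simp [h2 e he, h2' e he],
      fun e => ?_⟩
    simp only [Pi.add_apply, add_smul, Finset.sum_add_distrib, h3, h3', add_zero]
  smul_mem' := by
    rintro r f ⟨h1, h2, h3⟩
    refine ⟨fun e he => by simp [h1 e he], fun e he => by simp [h2 e he], fun e => ?_⟩
    simp only [Pi.smul_apply, smul_eq_mul, mul_smul, ← Finset.smul_sum, h3, smul_zero]

lemma N_coord (V : Fin n → Fin d → ℝ) (s : MvPolynomial (Fin n) ℝ) (e) (j : Fin d) :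
    N (coordDiff V j s) e = (∑ i, N s (e + Finsupp.single i 1) • V i) j := by
  simp only [coordDiff, linDiff, LinearMap.sum_apply, map_sum, Finset.sum_apply,
    LinearMap.smul_apply, map_smul, Pi.smul_apply, N_pd, smul_eq_mul]
  exact Finset.sum_congr rfl fun i _ => mul_comm _ _

lemma mem_stressK (V : Fin n → Fin d → ℝ) (Δ : Set (Finset (Fin n))) (hΔ : IsComplex Δ) (k : ℕ)
    (s : MvPolynomial (Fin n) ℝ) : s ∈ stressK V Δ k ↔ N s ∈ W V Δ k := by
  have key : ∀ t : MvPolynomial (Fin n) ℝ, t = 0 ↔ ∀ e, N t e = 0 := fun t =>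
    ⟨fun h => by simp [h], fun h => N_inj (by ext e; simp [h])⟩
  unfold stressK stress tStress
  simp only [Submodule.mem_inf, Submodule.mem_iInf, LinearMap.mem_ker, Set.mem_setOf_eq]
  constructor
  · rintro ⟨⟨h1, h2⟩, h3⟩
    refine ⟨fun e he => ?_, fun e he => ?_, fun e => ?_⟩
    · have := (key _).1 (h1 e he) 0
      rwa [N_monDiff, zero_add] at this
    · rw [N_apply, IsHomogeneous.coeff_eq_zero h3 he, zero_mul]
    · ext j
      rw [← N_coord, h2 j]; simp
  · rintro ⟨h1, h2, h3⟩
    refine ⟨⟨fun a ha => (key _).2 fun e => ?_, fun j => (key _).2 fun e => ?_⟩, ?_⟩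
    · rw [N_monDiff]
      apply h1
      intro h
      apply ha
      apply hΔ _ h
      intro i hi
      simp only [Finsupp.mem_support_iff, Finsupp.add_apply] at hi ⊢
      omega
    · rw [N_coord, h3 e]; rfl
    · rw [mem_homogeneousSubmodule]
      intro e he
      by_contra hne'
      have hne : e.degree ≠ k := by
        rw [Finsupp.degree_eq_weight_one]; exact hne'
      have := h2 e hne
      rw [N_apply] at this
      exact he ((mul_eq_zero.1 this).resolve_right (fac_ne e))

lemma exists_poly (V : Fin n → Fin d → ℝ) (Δ : Set (Finset (Fin n))) (k : ℕ)
    (f : (Fin n →₀ ℕ) → ℝ) (hf : f ∈ W V Δ k) : ∃ s, N s = f := by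
  classical
  refine ⟨∑ e ∈ (Finsupp.finite_of_degree_eq (σ := Fin n) k).toFinset, monomial e (f e / fac e), ?_⟩
  ext e
  rw [N_apply, coeff_sum]
  simp only [coeff_monomial, Finset.sum_ite_eq']
  by_cases h : e.degree = k
  · simp [h, div_mul_cancel₀ _ (fac_ne e)]
  · simp [h, hf.2.1 e h]

/-- Complex generated by a list. -/
def Dl (L : List (Finset (Fin n))) : Set (Finset (Fin n)) := {τ | ∃ F ∈ L, τ ⊆ F}

def Sh : List (Finset (Fin n)) → Prop
  | [] => True
  | F :: L => Sh L ∧ ∀ τ ⊆ F, τ ∈ Dl L → ∃ w ∈ F, w ∉ τ ∧ F.erase w ∈ Dl L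

lemma Sh_filter (v : Fin n) (L : List (Finset (Fin n))) (h : Sh L) :
    Sh (L.filter (fun F => v ∈ F)) := by
  induction L with
  | nil => trivial
  | cons F L ih =>
    by_cases hv : v ∈ F
    · rw [List.filter_cons_of_pos (by simpa using hv)]
      refine ⟨ih h.1, fun τ hτ ⟨G, hG, hτG⟩ => ?_⟩
      rw [List.mem_filter] at hG
      have hvG : v ∈ G := by simpa using hG.2
      obtain ⟨w, hw, hwt, G', hG', hs⟩ := h.2 (insert v τ) (Finset.insert_subset hv hτ)
        ⟨G, hG.1, Finset.insert_subset hvG hτG⟩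
      rw [Finset.mem_insert, not_or] at hwt
      refine ⟨w, hw, hwt.2, G', ?_, hs⟩
      rw [List.mem_filter]
      exact ⟨hG', by simpa using hs (Finset.mem_erase.2 ⟨Ne.symm hwt.1, hv⟩)⟩
    · rw [List.filter_cons_of_neg (by simpa using hv)]
      exact ih h.1

lemma W_mono (V : Fin n → Fin d → ℝ) {Δ Γ : Set (Finset (Fin n))} (h : Δ ⊆ Γ) (k : ℕ) :
    W V Δ k ≤ W V Γ k := fun _ hf => ⟨fun e he => hf.1 e fun h' => he (h h'), hf.2⟩

open Classical in
/-- Restriction set. -/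
noncomputable def Rs (F : Finset (Fin n)) (L : List (Finset (Fin n))) : Finset (Fin n) :=
  F.filter fun w => F.erase w ∈ Dl L

lemma Rs_subset (F : Finset (Fin n)) (L : List (Finset (Fin n))) : Rs F L ⊆ F := by
  classical
  exact Finset.filter_subset _ _

/-- indicator exponent -/
noncomputable def ind (R : Finset (Fin n)) : Fin n →₀ ℕ := Finsupp.indicator R fun _ _ => 1

lemma ind_apply (R : Finset (Fin n)) (i) : ind R i = if i ∈ R then 1 else 0 := by
  simp [ind, Finsupp.indicator_apply]

lemma ind_degree (R : Finset (Fin n)) : (ind R).degree = R.card := by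
  rw [Finsupp.degree_eq_sum]; simp [ind_apply]

/-- Facet condition -/
def Fac (V : Fin n → Fin d → ℝ) (F : Finset (Fin n)) : Prop :=
  F.card = d ∧ LinearIndependent ℝ (fun i : {x // x ∈ F} => V i.1)

lemma Fac.dual {V : Fin n → Fin d → ℝ} {F : Finset (Fin n)} (h : Fac V F) {w : Fin n} (hw : w ∈ F) :
    ∃ ψ : (Fin d → ℝ) →ₗ[ℝ] ℝ, ψ (V w) = 1 ∧ ∀ u ∈ F, u ≠ w → ψ (V u) = 0 := by
  obtain ⟨hc, hl⟩ := h
  haveI : Nonempty {x // x ∈ F} := ⟨⟨w, hw⟩⟩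
  let b := basisOfLinearIndependentOfCardEqFinrank hl (by simp [hc])
  have hb : ∀ u : {x // x ∈ F}, b u = V u := fun u => by simp [b]
  refine ⟨b.coord ⟨w, hw⟩, ?_, fun u hu hne => ?_⟩
  · rw [← hb ⟨w, hw⟩]; simp
  · rw [← hb ⟨u, hu⟩]
    simp [Finsupp.single_apply, hne]

lemma R_subset_iff {F : Finset (Fin n)} {L : List (Finset (Fin n))} (h : Sh (F :: L))
    {τ : Finset (Fin n)} (hτ : τ ⊆ F) : τ ∉ Dl L ↔ Rs F L ⊆ τ := by
  constructor
  · intro hn w hw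
    simp only [Rs, Finset.mem_filter] at hw
    by_contra hwt
    obtain ⟨G, hG, hs⟩ := hw.2
    refine hn ⟨G, hG, fun x hx => hs (Finset.mem_erase.2 ⟨?_, hτ hx⟩)⟩
    rintro rfl
    exact hwt hx
  · intro hR hD
    obtain ⟨w, hw, hwt, hs⟩ := h.2 τ hτ hD
    exact hwt (hR (by simp [Rs, hw, hs]))

lemma rel {V : Fin n → Fin d → ℝ} {F : Finset (Fin n)} {L : List (Finset (Fin n))} (h : Sh (F :: L))
    (hF : Fac V F) {m : ℕ} {s : (Fin n →₀ ℕ) → ℝ} (hs : s ∈ W V (Dl (F :: L)) m)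
    (hm : m ≠ (Rs F L).card ∨ s (ind (Rs F L)) = 0) : s ∈ W V (Dl L) m := by
  set R := Rs F L with hRdef
  have hRF : R ⊆ F := Rs_subset F L
  have hRn : ∀ τ, R ⊆ τ → τ ∉ Dl L := by
    rintro τ hτ ⟨G, hG, hG'⟩
    exact (R_subset_iff h hRF).2 subset_rfl ⟨G, hG, hτ.trans hG'⟩
  -- main vanishing
  have van : ∀ e : Fin n →₀ ℕ, R ⊆ e.support → e.support ⊆ F → ∀ w ∈ F,
      s (e + Finsupp.single w 1) = 0 := by
    intro e hRe heF w hw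
    obtain ⟨ψ, h1, h0⟩ := hF.dual hw
    have := congrArg ψ (hs.2.2 e)
    rw [map_sum, map_zero, Finset.sum_eq_single w] at this
    · simpa [h1] using this
    · intro u _ huw
      rw [map_smul]
      by_cases hu : u ∈ F
      · simp [h0 u hu huw]
      · rw [hs.1, zero_smul]
        rintro ⟨G, hG, hsub⟩
        have hsupp : (e + Finsupp.single u 1).support = e.support ∪ {u} := by
          ext x; by_cases hx : x = u <;> simp [Finsupp.single_apply, hx, eq_comm]
        rw [hsupp] at hsub
        rcases List.mem_cons.1 hG with rfl | hG
        · exact hu (hsub (by simp))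
        · exact hRn _ (hRe.trans Finset.subset_union_left) ⟨G, hG, hsub⟩
    · simp
  refine ⟨fun e he => ?_, hs.2⟩
  by_cases heF : e.support ⊆ F
  swap
  · apply hs.1
    rintro ⟨G, hG, hsub⟩
    rcases List.mem_cons.1 hG with rfl | hG
    · exact heF hsub
    · exact he ⟨G, hG, hsub⟩
  have hRe : R ⊆ e.support := (R_subset_iff h heF).1 he
  by_cases hei : e = ind R
  · rcases hm with hm | hm
    · apply hs.2.1
      rw [hei, ind_degree]; exact hm.symm
    · rw [hei]; exact hm
  · obtain ⟨w, hw⟩ : ∃ w, ind R w < e w := by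
      by_contra hcon
      push Not at hcon
      apply hei
      ext x
      apply le_antisymm (hcon x)
      rw [ind_apply]
      split_ifs with hx
      · have := hRe hx
        rw [Finsupp.mem_support_iff] at this
        omega
      · omega
    have hle : Finsupp.single w 1 ≤ e := by
      rw [Finsupp.single_le_iff]; omega
    have hsum : e - Finsupp.single w 1 + Finsupp.single w 1 = e := tsub_add_cancel_of_le hle
    rw [← hsum]
    apply van
    · intro x hx
      have h1 := hRe hx
      rw [Finsupp.mem_support_iff] at h1 ⊢
      rw [Finsupp.tsub_apply, Finsupp.single_apply]
      split_ifs with hxw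
      · subst hxw
        rw [ind_apply, if_pos hx] at hw
        omega
      · omega
    · intro x hx
      apply heF
      rw [Finsupp.mem_support_iff] at hx ⊢
      rw [Finsupp.tsub_apply] at hx
      omega
    · apply heF
      rw [Finsupp.mem_support_iff]; omega

/-- Good points. -/
def Good (V : Fin n → Fin d → ℝ) (c : Fin d → ℝ) (p : Finset (Fin n) → Fin n → ℝ)
    (F : Finset (Fin n)) : Prop :=
  (∀ i, p F i ≠ 0 ↔ i ∈ F) ∧ ∑ i, p F i • V i = c

def pw (q : Fin n → ℝ) (e : Fin n →₀ ℕ) : ℝ := ∏ i, q i ^ e i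

lemma pw_succ (q : Fin n → ℝ) (e : Fin n →₀ ℕ) (i : Fin n) :
    pw q (e + Finsupp.single i 1) = pw q e * q i := by
  simp only [pw, Finsupp.add_apply, pow_add, Finset.prod_mul_distrib]
  congr 1
  rw [Finset.prod_eq_single i]
  · simp
  · intro j _ hj; simp [Finsupp.single_apply, hj.symm]
  · simp

def mom (p : Finset (Fin n) → Fin n → ℝ) (a : Finset (Fin n) → ℝ) (e : Fin n →₀ ℕ) : ℝ :=
  ∑ F, a F * pw (p F) e

noncomputable def M (p : Finset (Fin n) → Fin n → ℝ) (m : ℕ) (a : Finset (Fin n) → ℝ) (e : Fin n →₀ ℕ) : ℝ :=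
  if e.degree = m then mom p a e else 0

lemma mom_add_smul (p : Finset (Fin n) → Fin n → ℝ) (a b : Finset (Fin n) → ℝ) (r : ℝ) (e) :
    mom p (a + r • b) e = mom p a e + r * mom p b e := by
  simp only [mom, Finset.mul_sum, ← Finset.sum_add_distrib]
  exact Finset.sum_congr rfl fun F _ => by simp; ring

lemma M_mem {V : Fin n → Fin d → ℝ} {c : Fin d → ℝ} {p : Finset (Fin n) → Fin n → ℝ}
    {L : List (Finset (Fin n))} (hg : ∀ F ∈ L, Good V c p F) {a : Finset (Fin n) → ℝ}
    (ha : ∀ F, F ∉ L → a F = 0) {m : ℕ} (h0 : ∀ e, e.degree < m → mom p a e = 0) :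
    M p m a ∈ W V (Dl L) m := by
  refine ⟨fun e he => ?_, fun e he => if_neg he, fun e => ?_⟩
  · unfold M
    split_ifs
    swap; · rfl
    apply Finset.sum_eq_zero
    intro F _
    by_cases hF : F ∈ L
    · have : ¬ e.support ⊆ F := fun h => he ⟨F, hF, h⟩
      obtain ⟨i, hi, hiF⟩ := Finset.not_subset.1 this
      have : p F i = 0 := by
        by_contra hne; exact hiF (((hg F hF).1 i).1 hne)
      rw [pw, Finset.prod_eq_zero (Finset.mem_univ i), mul_zero]
      rw [this, zero_pow (Finsupp.mem_support_iff.1 hi)]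
    · rw [ha F hF, zero_mul]
  · by_cases hm : e.degree + 1 = m
    · have : ∀ i, M p m a (e + Finsupp.single i 1) = ∑ F, a F * pw (p F) e * p F i := by
        intro i
        rw [M, if_pos (by simp [hm]), mom]
        exact Finset.sum_congr rfl fun F _ => by rw [pw_succ, mul_assoc]
      simp only [this, Finset.sum_smul, mul_smul]
      rw [Finset.sum_comm]
      have h2 : ∀ F, ∑ i, a F • pw (p F) e • p F i • V i = (a F * pw (p F) e) • c := by
        intro F
        by_cases hF : F ∈ L
        · rw [← (hg F hF).2, mul_smul, Finset.smul_sum, Finset.smul_sum]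
        · simp [ha F hF]
      simp only [h2]
      rw [← Finset.sum_smul]
      have := h0 e (by omega)
      rw [mom] at this
      rw [this, zero_smul]
    · apply Finset.sum_eq_zero
      intro i _
      rw [M, if_neg (by simpa using hm), zero_smul]

lemma mom_top {V : Fin n → Fin d → ℝ} {c : Fin d → ℝ} {p : Finset (Fin n) → Fin n → ℝ}
    {L : List (Finset (Fin n))} (hg : ∀ F ∈ L, Good V c p F) (hc : ∀ F ∈ L, F.card = d)
    {a : Finset (Fin n) → ℝ}
    (ha : ∀ F, F ∉ L → a F = 0) {F : Finset (Fin n)} (hF : F ∈ L) (haF : a F ≠ 0) :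
    mom p a (ind F) ≠ 0 := by
  rw [mom, Finset.sum_eq_single F]
  · apply mul_ne_zero haF
    apply Finset.prod_ne_zero_iff.2
    intro i _
    rw [ind_apply]
    split_ifs with hi
    · simpa using ((hg F hF).1 i).2 hi
    · simp
  · intro G _ hGF
    by_cases hG : G ∈ L
    · have : ¬ F ⊆ G := fun h => hGF (Finset.eq_of_subset_of_card_le h (by rw [hc F hF, hc G hG])).symm
      obtain ⟨i, hi, hiG⟩ := Finset.not_subset.1 this
      have : p G i = 0 := by
        by_contra hne; exact hiG (((hg G hG).1 i).1 hne)
      rw [pw, Finset.prod_eq_zero (Finset.mem_univ i), mul_zero]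
      simp [this, ind_apply, hi]
    · rw [ha G hG, zero_mul]
  · simp

def A (V : Fin n → Fin d → ℝ) (p : Finset (Fin n) → Fin n → ℝ) (L : List (Finset (Fin n))) : Prop :=
  ∀ m, ∀ s ∈ W V (Dl L) m, ∃ a : Finset (Fin n) → ℝ, (∀ F, F ∉ L → a F = 0) ∧
    (∀ e, e.degree < m → mom p a e = 0) ∧ M p m a = s

lemma exists_new {V : Fin n → Fin d → ℝ} {c : Fin d → ℝ} {p : Finset (Fin n) → Fin n → ℝ}
    {F : Finset (Fin n)} {L : List (Finset (Fin n))} (hsh : Sh (F :: L)) (hnd : F ∉ L)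
    (hg : ∀ G ∈ F :: L, Good V c p G) (hf : ∀ G ∈ F :: L, Fac V G) (hA : A V p L) :
    ∃ a : Finset (Fin n) → ℝ, (∀ G, G ∉ F :: L → a G = 0) ∧
      (∀ e, e.degree < (Rs F L).card → mom p a e = 0) ∧
      M p (Rs F L).card a ∈ W V (Dl (F :: L)) (Rs F L).card ∧ M p (Rs F L).card a (ind (Rs F L)) ≠ 0 := by
  classical
  let P : ℕ → Prop := fun m => ∃ a : Finset (Fin n) → ℝ, (∀ G, G ∉ F :: L → a G = 0) ∧ a F = 1 ∧
    (∀ e, e.degree < m → mom p a e = 0)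
  have hP0 : P 0 := ⟨Pi.single F 1, fun G hG => by
    rw [List.mem_cons, not_or] at hG; simp [hG.1], by simp, by simp⟩
  have hPd : ∀ m, P m → m ≤ d := by
    rintro m ⟨a, ha, haF, h0⟩
    by_contra hlt
    refine mom_top hg (fun G hG => (hf G hG).1) ha (F := F) (by simp) (by simp [haF]) (h0 _ ?_)
    rw [ind_degree, (hf F (by simp)).1]; omega
  obtain ⟨m, hm, hmax⟩ : ∃ m, P m ∧ ¬ P (m + 1) := by
    by_contra hcon
    push Not at hcon
    have : ∀ m, P m := fun m => by
      induction m with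
      | zero => exact hP0
      | succ m ih => exact hcon m ih
    have := hPd _ (this (d + 1))
    omega
  obtain ⟨a, ha, haF, h0⟩ := hm
  have hW := M_mem hg ha h0
  have hnot : M p m a ∉ W V (Dl L) m := by
    intro hmem
    obtain ⟨b, hb, hb0, hbM⟩ := hA m _ hmem
    apply hmax
    refine ⟨a + (-1 : ℝ) • b, fun G hG => ?_, ?_, fun e he => ?_⟩
    · simp [ha G hG, hb G (fun h => hG (List.mem_cons_of_mem _ h))]
    · simp [haF, hb F hnd]
    · rw [mom_add_smul]
      rcases Nat.lt_succ_iff_lt_or_eq.1 he with h | h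
      · simp [h0 e h, hb0 e h]
      · have := congrFun hbM e
        simp only [M, if_pos h] at this
        rw [this]; ring
  have hmR : m = (Rs F L).card := by
    by_contra hne
    exact hnot (rel hsh (hf F (by simp)) hW (Or.inl hne))
  subst hmR
  exact ⟨a, ha, h0, hW, fun h => hnot (rel hsh (hf F (by simp)) hW (Or.inr h))⟩

lemma A_all {V : Fin n → Fin d → ℝ} {c : Fin d → ℝ} {p : Finset (Fin n) → Fin n → ℝ}
    (L : List (Finset (Fin n))) (hsh : Sh L) (hnd : L.Nodup)
    (hg : ∀ G ∈ L, Good V c p G) (hf : ∀ G ∈ L, Fac V G) : A V p L := by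
  induction L with
  | nil =>
    intro m s hs
    refine ⟨0, by simp, by simp [mom], ?_⟩
    ext e
    rw [hs.1 e (by simp [Dl])]
    simp [M, mom]
  | cons F L ih =>
    rw [List.nodup_cons] at hnd
    have hA := ih hsh.1 hnd.2 (fun G hG => hg G (List.mem_cons_of_mem _ hG))
      (fun G hG => hf G (List.mem_cons_of_mem _ hG))
    have low : ∀ m, ∀ s ∈ W V (Dl L) m, ∃ a : Finset (Fin n) → ℝ, (∀ G, G ∉ F :: L → a G = 0) ∧
        (∀ e, e.degree < m → mom p a e = 0) ∧ M p m a = s := by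
      intro m s hs
      obtain ⟨a, h1, h2, h3⟩ := hA m s hs
      exact ⟨a, fun G hG => h1 G (fun h => hG (List.mem_cons_of_mem _ h)), h2, h3⟩
    intro m s hs
    by_cases hm : m = (Rs F L).card
    · obtain ⟨a, ha, h0, hW, hne⟩ := exists_new hsh hnd.1 hg hf hA
      subst hm
      set r := s (ind (Rs F L)) / M p (Rs F L).card a (ind (Rs F L)) with hr
      have hs' : s + (-r) • M p (Rs F L).card a ∈ W V (Dl L) (Rs F L).card := by
        refine rel hsh (hf F (by simp)) (add_mem hs (Submodule.smul_mem _ _ hW)) (Or.inr ?_)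
        simp only [Pi.add_apply, Pi.smul_apply, smul_eq_mul, hr]
        field_simp
        ring
      obtain ⟨b, hb, hb0, hbM⟩ := low _ _ hs'
      refine ⟨b + r • a, fun G hG => by simp [ha G hG, hb G hG], fun e he => by
        rw [mom_add_smul, h0 e he, hb0 e he]; simp, ?_⟩
      ext e
      have := congrFun hbM e
      simp only [M, mom_add_smul, Pi.add_apply, Pi.smul_apply, smul_eq_mul] at this ⊢
      split_ifs at this ⊢ <;> linarith
    · exact low m s (rel hsh (hf F (by simp)) hs (Or.inl hm))

lemma Dl_mono {L L' : List (Finset (Fin n))} (h : L ⊆ L') : Dl L ⊆ Dl L' :=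
  fun _ ⟨F, hF, hs⟩ => ⟨F, h hF, hs⟩

lemma Rs_filter {F : Finset (Fin n)} {L : List (Finset (Fin n))} {v : Fin n} (hv : v ∈ F)
    (hvR : v ∉ Rs F L) : Rs F (L.filter (fun G => v ∈ G)) = Rs F L := by
  ext w
  simp only [Rs, Finset.mem_filter] at hvR ⊢
  refine and_congr_right fun hw => ⟨fun h => Dl_mono (List.filter_subset_self _) h, ?_⟩
  rintro ⟨G, hG, hs⟩
  refine ⟨G, List.mem_filter.2 ⟨hG, ?_⟩, hs⟩
  have : v ≠ w := by
    rintro rfl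
    exact hvR ⟨hv, G, hG, hs⟩
  simpa using hs (Finset.mem_erase.2 ⟨this, hv⟩)

lemma B_all {V : Fin n → Fin d → ℝ} {c : Fin d → ℝ} {p : Finset (Fin n) → Fin n → ℝ} {k : ℕ}
    (hk : k < d) (L : List (Finset (Fin n))) (hsh : Sh L) (hnd : L.Nodup)
    (hg : ∀ G ∈ L, Good V c p G) (hf : ∀ G ∈ L, Fac V G) :
    W V (Dl L) k ≤ ⨆ v : Fin n, W V (Dl (L.filter (fun G => v ∈ G))) k := by
  induction L with
  | nil =>
    intro s hs
    have : s = 0 := by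
      ext e
      exact hs.1 e (by simp [Dl])
    rw [this]; exact zero_mem _
  | cons F L ih =>
    have hnd' := List.nodup_cons.1 hnd
    have hg' : ∀ G ∈ L, Good V c p G := fun G hG => hg G (List.mem_cons_of_mem _ hG)
    have hf' : ∀ G ∈ L, Fac V G := fun G hG => hf G (List.mem_cons_of_mem _ hG)
    have low : W V (Dl L) k ≤ ⨆ v : Fin n, W V (Dl ((F :: L).filter (fun G => v ∈ G))) k := by
      refine (ih hsh.1 hnd'.2 hg' hf').trans (iSup_mono fun v => W_mono V (Dl_mono ?_) k)
      intro G hG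
      rw [List.mem_filter] at hG ⊢
      exact ⟨List.mem_cons_of_mem _ hG.1, hG.2⟩
    intro s hs
    by_cases hm : k = (Rs F L).card
    swap
    · exact low (rel hsh (hf F (by simp)) hs (Or.inl hm))
    subst hm
    have hRF : Rs F L ⊆ F := Rs_subset F L
    obtain ⟨v, hv, hvR⟩ : ∃ v ∈ F, v ∉ Rs F L := by
      by_contra hcon
      push Not at hcon
      have := Finset.card_le_card hcon
      rw [(hf F (by simp)).1] at this
      omega
    have hfil : (F :: L).filter (fun G => v ∈ G) = F :: L.filter (fun G => v ∈ G) :=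
      List.filter_cons_of_pos (by simpa using hv)
    have hshv := Sh_filter v _ hsh
    have hgv : ∀ G ∈ (F :: L).filter (fun G => v ∈ G), Good V c p G :=
      fun G hG => hg G (List.mem_filter.1 hG).1
    have hfv : ∀ G ∈ (F :: L).filter (fun G => v ∈ G), Fac V G :=
      fun G hG => hf G (List.mem_filter.1 hG).1
    have hsub : Dl ((F :: L).filter (fun G => v ∈ G)) ⊆ Dl (F :: L) := Dl_mono (List.filter_subset_self _)
    have hle : W V (Dl ((F :: L).filter (fun G => v ∈ G))) (Rs F L).card ≤
      ⨆ v : Fin n, W V (Dl ((F :: L).filter (fun G => v ∈ G))) (Rs F L).card :=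
        le_iSup (fun v : Fin n => W V (Dl ((F :: L).filter (fun G => v ∈ G))) (Rs F L).card) v
    rw [hfil] at hshv hgv hfv hsub hle
    have hAv : A V p (L.filter (fun G => v ∈ G)) :=
      A_all _ hshv.1 (hnd'.2.filter _) (fun G hG => hgv G (List.mem_cons_of_mem _ hG))
        (fun G hG => hfv G (List.mem_cons_of_mem _ hG))
    obtain ⟨a, -, -, hW, hne⟩ := exists_new hshv
      (fun h => hnd'.1 (List.mem_filter.1 h).1) hgv hfv hAv
    rw [Rs_filter hv hvR] at hW hne
    set t := M p (Rs F L).card a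
    set r := s (ind (Rs F L)) / t (ind (Rs F L)) with hr
    have hs' : s + (-r) • t ∈ W V (Dl L) (Rs F L).card := by
      refine rel hsh (hf F (by simp))
        (add_mem hs (Submodule.smul_mem _ _ (W_mono V hsub _ hW))) (Or.inr ?_)
      simp only [Pi.add_apply, Pi.smul_apply, smul_eq_mul, hr]
      field_simp
      ring
    have : s = (s + (-r) • t) + r • t := by module
    rw [this]
    exact add_mem (low hs') (Submodule.smul_mem _ _ (hle hW))

lemma exists_generic (V : Fin n → Fin d → ℝ) : ∃ c : Fin d → ℝ,
    ∀ σ : Finset (Fin n), σ.card < d → c ∉ Submodule.span ℝ (V '' (σ : Set (Fin n))) := by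
  classical
  by_contra hcon
  push Not at hcon
  let S : Finset (Subspace ℝ (Fin d → ℝ)) :=
    (Finset.univ.filter fun σ : Finset (Fin n) => σ.card < d).image
      fun σ : Finset (Fin n) => Submodule.span ℝ (V '' (σ : Set (Fin n)))
  have htop : (⊤ : Subspace ℝ (Fin d → ℝ)) ∈ S := by
    apply Subspace.top_mem_of_biUnion_eq_univ
    ext c
    simp only [Set.mem_iUnion, Set.mem_univ, iff_true]
    obtain ⟨σ, h1, h2⟩ := hcon c
    exact ⟨_, Finset.mem_image.2 ⟨σ, by simpa using h1, rfl⟩, h2⟩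
  obtain ⟨σ, hσ, hs⟩ := Finset.mem_image.1 htop
  have hσ : σ.card < d := by simpa using hσ
  have h1 := finrank_span_finset_le_card (R := ℝ) (σ.image V)
  rw [Finset.coe_image, Set.finrank, hs] at h1
  have h2 := Finset.card_image_le (s := σ) (f := V)
  have h3 : Module.finrank ℝ (⊤ : Submodule ℝ (Fin d → ℝ)) = d := by simp
  have h1' : Module.finrank ℝ (⊤ : Submodule ℝ (Fin d → ℝ)) ≤ (σ.image V).card := h1
  omega

lemma exists_point (V : Fin n → Fin d → ℝ) (c : Fin d → ℝ)
    (hc : ∀ σ : Finset (Fin n), σ.card < d → c ∉ Submodule.span ℝ (V '' (σ : Set (Fin n))))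
    (F : Finset (Fin n)) (hF : Fac V F) :
    ∃ q : Fin n → ℝ, (∀ i, q i ≠ 0 ↔ i ∈ F) ∧ ∑ i, q i • V i = c := by
  classical
  obtain ⟨hcard, hl⟩ := hF
  have htop : Submodule.span ℝ (Set.range fun i : {x // x ∈ F} => V i.1) = ⊤ :=
    hl.span_eq_top_of_card_eq_finrank' (by simp [hcard])
  have hmem : c ∈ Submodule.span ℝ (Set.range fun i : {x // x ∈ F} => V i.1) := by
    rw [htop]; trivial
  obtain ⟨q, hq⟩ := (Submodule.mem_span_range_iff_exists_fun ℝ).1 hmem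
  let q' : Fin n → ℝ := fun i => if h : i ∈ F then q ⟨i, h⟩ else 0
  have hsum : ∑ i, q' i • V i = c := by
    rw [← hq, ← Finset.sum_subset (Finset.subset_univ F), ← Finset.sum_coe_sort F]
    · exact Finset.sum_congr rfl fun i _ => by simp [q']
    · intro i _ hi; simp [q', hi]
  refine ⟨q', fun i => ⟨fun h => ?_, fun hi h0 => ?_⟩, hsum⟩
  · by_contra hi; exact h (by simp [q', hi])
  · apply hc (F.erase i)
    · rw [Finset.card_erase_of_mem hi, hcard]
      have := Finset.card_pos.2 ⟨i, hi⟩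
      omega
    · rw [← hsum]
      refine Submodule.sum_mem _ fun j _ => ?_
      by_cases hj : j ∈ F
      · by_cases hji : j = i
        · rw [hji, h0, zero_smul]; exact zero_mem _
        · exact Submodule.smul_mem _ _ (Submodule.subset_span ⟨j, by simp [hj, hji], rfl⟩)
      · simp [q', hj]

lemma Sh_of {d : ℕ} (hd : 0 < d) (L : List (Finset (Fin n))) (hc : ∀ F ∈ L, F.card = d)
    (h : ∀ (i : ℕ) (hi : i < L.length) (τ : Finset (Fin n)), τ ⊆ L.get ⟨i, hi⟩ →
    (∃ (j : ℕ) (hj : j < L.length), i < j ∧ τ ⊆ L.get ⟨j, hj⟩) →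
    ∃ ρ, τ ⊆ ρ ∧ ρ ⊆ L.get ⟨i, hi⟩ ∧ ρ.card = d - 1 ∧
      ∃ (j : ℕ) (hj : j < L.length), i < j ∧ ρ ⊆ L.get ⟨j, hj⟩) : Sh L := by
  induction L with
  | nil => trivial
  | cons F L ih =>
    refine ⟨ih (fun G hG => hc G (List.mem_cons_of_mem _ hG)) ?_, ?_⟩
    · intro i hi τ hτ ⟨j, hj, hij, hτj⟩
      obtain ⟨ρ, h1, h2, h3, j', hj', hij', h4⟩ := h (i + 1) (by simpa using hi) τ (by simpa using hτ)
        ⟨j + 1, by simpa using hj, by omega, by simpa using hτj⟩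
      obtain ⟨j'', rfl⟩ : ∃ j'', j' = j'' + 1 := ⟨j' - 1, by omega⟩
      exact ⟨ρ, h1, by simpa using h2, h3, j'', by simpa using hj', by omega, by simpa using h4⟩
    · rintro τ hτ ⟨G, hG, hτG⟩
      obtain ⟨j, hj, rfl⟩ := List.mem_iff_getElem.1 hG
      obtain ⟨ρ, h1, h2, h3, j', hj', hij', h4⟩ := h 0 (by simp) τ (by simpa using hτ)
        ⟨j + 1, by simpa using hj, by omega, by simpa using hτG⟩
      obtain ⟨j'', rfl⟩ : ∃ j'', j' = j'' + 1 := ⟨j' - 1, by omega⟩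
      have h2' : ρ ⊆ F := by simpa using h2
      have hFc := hc F (by simp)
      obtain ⟨w, hw, hwρ⟩ : ∃ w ∈ F, w ∉ ρ := by
        by_contra hcon
        push Not at hcon
        have := Finset.card_le_card hcon
        omega
      have : ρ = F.erase w := by
        apply Finset.eq_of_subset_of_card_le
        · intro x hx
          exact Finset.mem_erase.2 ⟨by rintro rfl; exact hwρ hx, h2' hx⟩
        · rw [Finset.card_erase_of_mem hw]; omega
      subst this
      exact ⟨w, hw, fun h => hwρ (h1 h), L[j'']'(by simpa using hj'), List.getElem_mem _,
        by simpa using h4⟩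

end Shell

theorem stmt17 {n d : ℕ} (V : Fin n → Fin d → ℝ) (Δ : Set (Finset (Fin n)))
    (hΔ : IsComplex Δ) (hp : IsProper V Δ)
    (L : List (Finset (Fin n))) (hL : IsShelling Δ d L) (k : ℕ) (hk : k < d) :
    ∀ γ ∈ stressK V Δ k, ∃ g : Fin n → MvPolynomial (Fin n) ℝ,
      (∀ v, g v ∈ stressK V (vStar Δ v) k) ∧ ∑ v, g v = γ := by
  classical
  intro γ hγ
  obtain ⟨hnd, hmem, hcov, hord⟩ := hL
  have hDl : Shell.Dl L = Δ := by
    ext τ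
    exact ⟨fun ⟨F, hF, hs⟩ => hΔ F ((hmem F).1 hF).1 τ hs, fun h => hcov τ h⟩
  have hstar : ∀ v, vStar Δ v = Shell.Dl (L.filter (fun G => v ∈ G)) := by
    intro v
    ext τ
    constructor
    · rintro ⟨-, h⟩
      obtain ⟨F, hF, hs⟩ := hcov _ h
      refine ⟨F, List.mem_filter.2 ⟨hF, ?_⟩, fun x hx => hs (by simp [hx])⟩
      simpa using hs (by simp : v ∈ {v} ∪ τ)
    · rintro ⟨F, hF, hs⟩
      rw [List.mem_filter] at hF
      have hv : v ∈ F := by simpa using hF.2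
      have hFΔ := ((hmem F).1 hF.1).1
      exact ⟨hΔ F hFΔ τ hs, hΔ F hFΔ _ (Finset.union_subset (by simpa using hv) hs)⟩
  have hstarC : ∀ v, IsComplex (vStar Δ v) := by
    intro v
    rw [hstar]
    rintro σ ⟨F, hF, hs⟩ τ hτ
    exact ⟨F, hF, hτ.trans hs⟩
  have hsh : Shell.Sh L := Shell.Sh_of (by omega) L (fun F hF => ((hmem F).1 hF).2) hord
  have hf : ∀ F ∈ L, Shell.Fac V F := fun F hF =>
    ⟨((hmem F).1 hF).2, hp F ((hmem F).1 hF).1 ((hmem F).1 hF).2.le⟩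
  obtain ⟨c, hc⟩ := Shell.exists_generic V
  have hpt : ∀ F : Finset (Fin n), ∃ q : Fin n → ℝ,
      F ∈ L → (∀ i, q i ≠ 0 ↔ i ∈ F) ∧ ∑ i, q i • V i = c := by
    intro F
    by_cases hF : F ∈ L
    · obtain ⟨q, hq⟩ := Shell.exists_point V c hc F (hf F hF)
      exact ⟨q, fun _ => hq⟩
    · exact ⟨0, fun h => absurd h hF⟩
  choose p hp' using hpt
  have hB := Shell.B_all (V := V) (c := c) (p := p) hk L hsh hnd hp' hf
  rw [Shell.mem_stressK V Δ hΔ] at hγ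
  rw [hDl] at hB
  have := hB hγ
  rw [Submodule.mem_iSup_iff_exists_finsupp] at this
  obtain ⟨f, hfm, hfs⟩ := this
  have hex : ∀ v, ∃ s, Shell.N s = f v := fun v => Shell.exists_poly V _ k _ (hfm v)
  choose g hg using hex
  refine ⟨g, fun v => ?_, ?_⟩
  · rw [Shell.mem_stressK V _ (hstarC v), hg, hstar]
    exact hfm v
  · apply Shell.N_inj
    rw [map_sum, ← hfs, Finsupp.sum_fintype _ _ (by simp)]
    exact Finset.sum_congr rfl fun v _ => hg v
end
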